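/- arXiv:1704.04252 — 3 statements merged into one kernel-verified Lean document; each statement's English description precedes it below -/
import Mathlib

section
/- Let p ∈ (1/2, 1) and let X be c_0 or l^q for some q ≥ 1. Then the transition operator W_p of the simple random walk on ℤ_+ is supercyclic on X: there exists x ∈ X such that {λ W_p^n x : λ ∈ ℂ, n ∈ ℕ} is dense in X. -/
open Filter

/-- The transition operator of the simple random walk on `ℤ₊` with partial reflection
at `0` and jump probability `p`: `(W_p x)_0 = (1-p) x_0 + p x_1` and
`(W_p x)_i = (1-p) x_{i-1} + p x_{i+1}` for `i ≥ 1`. -/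
noncomputable def Wop (p : ℝ) (x : ℕ → ℂ) : ℕ → ℂ := fun i =>
  if i = 0 then ((1 - p : ℝ) : ℂ) * x 0 + (p : ℂ) * x 1
  else ((1 - p : ℝ) : ℂ) * x (i - 1) + (p : ℂ) * x (i + 1)

/-- Membership in `c₀`: sequences tending to `0`. -/
def memc0 (x : ℕ → ℂ) : Prop := Filter.Tendsto x Filter.atTop (nhds 0)

/-- Membership in `ℓ^q`: `∑ ‖x n‖^q < ∞`. -/
def memlq (q : ℝ) (x : ℕ → ℂ) : Prop := Summable (fun n => ‖x n‖ ^ q)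

/-- Sup-norm distance between `x` and `z` is (at most) `ε`, coordinatewise strict form. -/
def distC0lt (x z : ℕ → ℂ) (ε : ℝ) : Prop := ∀ i, ‖x i - z i‖ < ε

/-- The `q`-th power of the `ℓ^q` distance between `x` and `z` is `< ε`. -/
def distLqlt (q : ℝ) (x z : ℕ → ℂ) (ε : ℝ) : Prop := (∑' i, ‖x i - z i‖ ^ q) < ε

/-- `T` is hypercyclic on the space given by membership predicate `mem` with
distance predicate `dlt`: some `x` in the space has dense orbit. -/
def HypercyclicOn (mem : (ℕ → ℂ) → Prop) (dlt : (ℕ → ℂ) → (ℕ → ℂ) → ℝ → Prop)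
    (T : (ℕ → ℂ) → (ℕ → ℂ)) : Prop :=
  ∃ x, mem x ∧ ∀ z, mem z → ∀ ε : ℝ, 0 < ε → ∃ n : ℕ, dlt (T^[n] x) z ε

/-- `T` is supercyclic on the space given by membership predicate `mem` with
distance predicate `dlt`: some `x` in the space has dense projective orbit. -/
def SupercyclicOn (mem : (ℕ → ℂ) → Prop) (dlt : (ℕ → ℂ) → (ℕ → ℂ) → ℝ → Prop)
    (T : (ℕ → ℂ) → (ℕ → ℂ)) : Prop :=
  ∃ x, mem x ∧ ∀ z, mem z → ∀ ε : ℝ, 0 < ε →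
    ∃ (lam : ℂ) (n : ℕ), dlt (fun i => lam * T^[n] x i) z ε

/-- `T` is frequently hypercyclic: some `x` in the space is such that for every ball
(center `z` in the space, radius `ε`), the set of times `n` with `T^[n] x` in the ball
has positive lower density. -/
def FreqHypercyclicOn (mem : (ℕ → ℂ) → Prop) (dlt : (ℕ → ℂ) → (ℕ → ℂ) → ℝ → Prop)
    (T : (ℕ → ℂ) → (ℕ → ℂ)) : Prop :=
  ∃ x, mem x ∧ ∀ z, mem z → ∀ ε : ℝ, 0 < ε →
    0 < Filter.liminf (fun N : ℕ =>
      (({n : ℕ | dlt (T^[n] x) z ε} ∩ Set.Icc 1 N).ncard : ℝ) / (N : ℝ)) Filter.atTop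

/-- `T` is Devaney chaotic: it is hypercyclic, its periodic points are dense, and it has
sensitive dependence on initial conditions. -/
def DevaneyOn (mem : (ℕ → ℂ) → Prop) (dlt : (ℕ → ℂ) → (ℕ → ℂ) → ℝ → Prop)
    (T : (ℕ → ℂ) → (ℕ → ℂ)) : Prop :=
  HypercyclicOn mem dlt T ∧
  (∀ z, mem z → ∀ ε : ℝ, 0 < ε →
    ∃ y, mem y ∧ (∃ n : ℕ, 1 ≤ n ∧ T^[n] y = y) ∧ dlt y z ε) ∧
  (∃ δ : ℝ, 0 < δ ∧ ∀ x, mem x → ∀ ε : ℝ, 0 < ε →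
    ∃ y, mem y ∧ dlt x y ε ∧ ∃ n : ℕ, ¬ dlt (T^[n] x) (T^[n] y) δ)

theorem Submodule.dense_of_forall_dual_eq_zero {X : Type*} [NormedAddCommGroup X] [NormedSpace ℂ X]
    (M : Submodule ℂ X) (h : ∀ f : X →L[ℂ] ℂ, (∀ x ∈ M, f x = 0) → f = 0) :
    Dense (M : Set X) := by
  rw [Submodule.dense_iff_topologicalClosure_eq_top, Submodule.eq_top_iff']
  intro x
  have : IsClosed (M.topologicalClosure : Set X) := M.isClosed_topologicalClosure
  rw [← Submodule.Quotient.mk_eq_zero]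
  refine SeparatingDual.eq_zero_of_forall_dual_eq_zero (R := ℂ) fun g => ?_
  have := h (g.comp M.topologicalClosure.mkQL) fun y hy => by
    have : (Submodule.Quotient.mk y : X ⧸ M.topologicalClosure) = 0 :=
      (Submodule.Quotient.mk_eq_zero _).2 (M.le_topologicalClosure hy)
    simp [this]
  simpa using congrArg (fun f : X →L[ℂ] ℂ => f x) this

/-- A surjective operator with dense generalized kernel on a separable Banach space
is supercyclic. -/
theorem exists_dense_projective_orbit {X : Type*} [NormedAddCommGroup X] [NormedSpace ℂ X]
    [CompleteSpace X] [TopologicalSpace.SeparableSpace X] (T R : X →L[ℂ] X)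
    (hTR : ∀ x, T (R x) = x) (hD : Dense {x : X | ∃ n : ℕ, (T ^ n) x = 0}) :
    ∃ x : X, ∀ z : X, ∀ ε : ℝ, 0 < ε → ∃ (c : ℂ) (n : ℕ), ‖c • (T ^ n) x - z‖ < ε := by
  have hTRn : ∀ (n : ℕ) (x : X), (T ^ n) ((R ^ n) x) = x := by
    intro n
    induction n with
    | zero => simp
    | succ n ih =>
      intro x
      rw [pow_succ T, pow_succ' R]
      simpa [hTR] using ih x
  have hpow : ∀ (m n : ℕ) (x : X), m ≤ n → (T ^ m) x = 0 → (T ^ n) x = 0 := by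
    intro m n x hmn hx
    obtain ⟨k, rfl⟩ := Nat.exists_eq_add_of_le' hmn
    simp [pow_add, hx]
  let u := TopologicalSpace.denseSeq X
  let O : ℕ × ℕ → Set X := fun j =>
    {x | ∃ (c : ℂ) (n : ℕ), ‖c • (T ^ n) x - u j.1‖ < 1 / ((j.2 : ℝ) + 1)}
  have hO : ∀ j, IsOpen (O j) := by
    intro j
    have : O j = ⋃ (c : ℂ), ⋃ (n : ℕ), {x | ‖c • (T ^ n) x - u j.1‖ < 1 / ((j.2 : ℝ) + 1)} := by
      ext x; simp [O]
    rw [this]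
    exact isOpen_iUnion fun c => isOpen_iUnion fun n =>
      isOpen_lt (by fun_prop) continuous_const
  have hOd : ∀ j, Dense (O j) := by
    intro j
    rw [Metric.dense_iff]
    intro x r hr
    obtain ⟨y, hy, n, hn⟩ := Metric.dense_iff.1 hD x r hr
    obtain ⟨δ, hδ, hδ'⟩ : ∃ δ : ℝ, 0 < δ ∧ dist y x + δ * ‖(R ^ n) (u j.1)‖ < r := by
      refine ⟨(r - dist y x) / (2 * (‖(R ^ n) (u j.1)‖ + 1)), ?_, ?_⟩
      · have : dist y x < r := hy
        exact div_pos (by linarith) (by positivity)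
      · have h1 : dist y x < r := hy
        have h2 : (0 : ℝ) ≤ ‖(R ^ n) (u j.1)‖ := norm_nonneg _
        have : (r - dist y x) / (2 * (‖(R ^ n) (u j.1)‖ + 1)) * ‖(R ^ n) (u j.1)‖
            < r - dist y x := by
          rw [div_mul_eq_mul_div, div_lt_iff₀ (by positivity)]
          nlinarith
        linarith
    refine ⟨y + (δ : ℂ) • (R ^ n) (u j.1), ?_, (δ : ℂ)⁻¹, n, ?_⟩
    · rw [Metric.mem_ball]
      refine lt_of_le_of_lt ?_ hδ'
      calc dist (y + (δ : ℂ) • (R ^ n) (u j.1)) x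
          = ‖(y - x) + (δ : ℂ) • (R ^ n) (u j.1)‖ := by rw [dist_eq_norm]; congr 1; abel
        _ ≤ ‖y - x‖ + ‖(δ : ℂ) • (R ^ n) (u j.1)‖ := norm_add_le _ _
        _ = _ := by rw [norm_smul, dist_eq_norm]; simp [abs_of_pos hδ]
    · have hδ0 : (δ : ℂ) ≠ 0 := by exact_mod_cast hδ.ne'
      rw [map_add, hn, zero_add, map_smul, hTRn, smul_smul, inv_mul_cancel₀ hδ0, one_smul,
        sub_self, norm_zero]
      positivity
  obtain ⟨x, hx⟩ := (dense_iInter_of_isOpen hO hOd).nonempty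
  refine ⟨x, fun z ε hε => ?_⟩
  obtain ⟨k, hk⟩ := exists_nat_one_div_lt (half_pos hε)
  obtain ⟨i, hi⟩ := (TopologicalSpace.denseRange_denseSeq X).exists_dist_lt z (half_pos hε)
  obtain ⟨c, n, hcn⟩ := Set.mem_iInter.1 hx (i, k)
  refine ⟨c, n, ?_⟩
  calc ‖c • (T ^ n) x - z‖ = ‖(c • (T ^ n) x - u i) + (u i - z)‖ := by congr 1; abel
    _ ≤ ‖c • (T ^ n) x - u i‖ + ‖u i - z‖ := norm_add_le _ _
    _ < ε / 2 + ε / 2 := by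
      refine add_lt_add (lt_trans hcn hk) ?_
      rw [← dist_eq_norm, dist_comm]; exact hi
    _ = ε := add_halves ε

theorem hasFPowerSeriesOnBall_tsum_of_bounded {φ : ℕ → ℂ} {M : ℝ} (hφ : ∀ i, ‖φ i‖ ≤ M) :
    HasFPowerSeriesOnBall (fun r : ℂ => ∑' i, φ i * r ^ i)
      (FormalMultilinearSeries.ofScalars ℂ φ) 0 1 := by
  have hrad : 1 ≤ (FormalMultilinearSeries.ofScalars ℂ φ).radius := by
    have := (FormalMultilinearSeries.ofScalars ℂ φ).le_radius_of_bound (r := 1) M fun n => by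
      simpa [FormalMultilinearSeries.ofScalars_norm] using hφ n
    simpa using this
  have h := ((FormalMultilinearSeries.ofScalars ℂ φ).hasFPowerSeriesOnBall
    (lt_of_lt_of_le one_pos hrad)).mono one_pos hrad
  refine h.congr fun r _ => ?_
  change FormalMultilinearSeries.ofScalarsSum φ r = _
  rw [FormalMultilinearSeries.ofScalars_sum_eq]
  simp

theorem differentiableAt_tsum_of_bounded {φ : ℕ → ℂ} {M : ℝ} (hφ : ∀ i, ‖φ i‖ ≤ M) {r : ℂ}
    (hr : ‖r‖ < 1) : DifferentiableAt ℂ (fun r : ℂ => ∑' i, φ i * r ^ i) r :=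
  ((hasFPowerSeriesOnBall_tsum_of_bounded hφ).analyticAt_of_mem (by
    simpa [Metric.mem_eball, edist_zero_right, ← ofReal_norm] using hr)).differentiableAt

theorem eq_zero_of_tsum_eventually_eq_zero {φ : ℕ → ℂ} {M : ℝ} (hφ : ∀ i, ‖φ i‖ ≤ M)
    (h : ∀ᶠ r : ℂ in nhds 0, ∑' i, φ i * r ^ i = 0) : φ = 0 := by
  have h0 := ((hasFPowerSeriesOnBall_tsum_of_bounded hφ).hasFPowerSeriesAt.congr
    (g := fun _ => (0 : ℂ)) h).eq_zero
  exact (FormalMultilinearSeries.ofScalars_series_eq_zero ℂ).1 h0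

/-- The identity theorem on the annulus `a < |r| < 1`. -/
theorem eqOn_annulus_of_eventuallyEq {a : ℝ} (ha : 0 < a) {G : ℂ → ℂ}
    (hG : ∀ r : ℂ, a < ‖r‖ → ‖r‖ < 1 → DifferentiableAt ℂ G r) {r₀ : ℂ} (h₀ : a < ‖r₀‖)
    (h₁ : ‖r₀‖ < 1) (h : ∀ᶠ r in nhds r₀, G r = 0) {r : ℂ} (hr : a < ‖r‖) (hr1 : ‖r‖ < 1) :
    G r = 0 := by
  set U : Set ℂ := {w | Real.log a < w.re} ∩ {w | w.re < 0} with hU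
  have hexp : ∀ w ∈ U, a < ‖Complex.exp w‖ ∧ ‖Complex.exp w‖ < 1 := by
    rintro w ⟨hw, hw'⟩
    rw [Complex.norm_exp]
    exact ⟨(Real.log_lt_iff_lt_exp ha).1 hw, by simpa using hw'⟩
  have hlog : ∀ s : ℂ, a < ‖s‖ → ‖s‖ < 1 → Complex.log s ∈ U ∧ Complex.exp (Complex.log s) = s := by
    intro s hs hs'
    have hs0 : 0 < ‖s‖ := ha.trans hs
    refine ⟨⟨?_, ?_⟩, Complex.exp_log (norm_pos_iff.1 hs0)⟩
    · simpa [Complex.log_re] using Real.log_lt_log ha hs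
    · simpa [Complex.log_re] using Real.log_neg hs0 hs'
  have hUo : IsOpen U := (isOpen_lt continuous_const Complex.continuous_re).inter
    (isOpen_lt Complex.continuous_re continuous_const)
  have hUc : IsPreconnected U :=
    ((convex_halfSpace_re_gt _).inter (convex_halfSpace_re_lt _)).isPreconnected
  have hd : DifferentiableOn ℂ (fun w => G (Complex.exp w)) U := fun w hw =>
    ((hG _ (hexp w hw).1 (hexp w hw).2).comp w Complex.differentiableAt_exp).differentiableWithinAt
  obtain ⟨hm, he⟩ := hlog r₀ h₀ h₁
  have hev : (fun w => G (Complex.exp w)) =ᶠ[nhds (Complex.log r₀)] 0 := by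
    have : Tendsto Complex.exp (nhds (Complex.log r₀)) (nhds r₀) := by
      simpa [he] using (Complex.continuous_exp.tendsto (Complex.log r₀))
    exact this.eventually h
  obtain ⟨hm', he'⟩ := hlog r hr hr1
  have := (hd.analyticOnNhd hUo).eqOn_zero_of_preconnected_of_eventuallyEq_zero hUc hm hev hm'
  simpa [he'] using this

theorem eq_zero_of_reflection_identity {a : ℝ} (ha : 0 < a) (ha1 : a < 1) {φ : ℕ → ℂ} {M : ℝ}
    (hφ : ∀ i, ‖φ i‖ ≤ M) {r₀ : ℂ} (h₀ : a < ‖r₀‖) (h₁ : ‖r₀‖ < 1)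
    (h : ∀ᶠ r : ℂ in nhds r₀, (1 - r / a) * ∑' i, φ i * r ^ i =
      (1 - 1 / r) * ∑' i, φ i * (a / r) ^ i) : φ = 0 := by
  set Φ : ℂ → ℂ := fun r => ∑' i, φ i * r ^ i with hΦ
  have hdΦ : ∀ r : ℂ, ‖r‖ < 1 → DifferentiableAt ℂ Φ r := fun r hr =>
    differentiableAt_tsum_of_bounded hφ hr
  have haC : (a : ℂ) ≠ 0 := by exact_mod_cast ha.ne'
  have hdA : ∀ r : ℂ, ‖r‖ < 1 → DifferentiableAt ℂ (fun r => (1 - r / a) * Φ r) r := by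
    intro r hr
    exact DifferentiableAt.mul (by fun_prop) (hdΦ r hr)
  have hdB : ∀ r : ℂ, a < ‖r‖ → DifferentiableAt ℂ (fun r => (1 - 1 / r) * Φ (a / r)) r := by
    intro r hr
    have hr0 : r ≠ 0 := norm_pos_iff.1 (ha.trans hr)
    have hn : ‖(a : ℂ) / r‖ < 1 := by
      rw [norm_div, Complex.norm_real, Real.norm_of_nonneg ha.le, div_lt_one (ha.trans hr)]
      exact hr
    refine DifferentiableAt.mul (by fun_prop (disch := assumption)) ?_
    exact DifferentiableAt.comp (f := fun r => (a : ℂ) / r) r (hdΦ _ hn)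
      (by fun_prop (disch := assumption))
  have hAB : ∀ r : ℂ, a < ‖r‖ → ‖r‖ < 1 → (1 - r / a) * Φ r = (1 - 1 / r) * Φ (a / r) := by
    intro r hr hr1
    exact sub_eq_zero.1 (eqOn_annulus_of_eventuallyEq ha
      (G := fun r => (1 - r / a) * Φ r - (1 - 1 / r) * Φ (a / r))
      (fun r hr hr1 => (hdA r hr1).sub (hdB r hr)) h₀ h₁ (h.mono fun r hr => sub_eq_zero.2 hr)
      hr hr1)
  set E : ℂ → ℂ := fun r => if ‖r‖ < 1 then (1 - r / a) * Φ r else (1 - 1 / r) * Φ (a / r) with hE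
  have hEB : ∀ r : ℂ, a < ‖r‖ → E r = (1 - 1 / r) * Φ (a / r) := by
    intro r hr
    by_cases hr1 : ‖r‖ < 1
    · simp only [hE, if_pos hr1]; exact hAB r hr hr1
    · simp only [hE, if_neg hr1]
  have hdE : Differentiable ℂ E := by
    intro r
    by_cases hr1 : ‖r‖ < 1
    · refine (hdA r hr1).congr_of_eventuallyEq ?_
      filter_upwards [(isOpen_lt continuous_norm continuous_const).mem_nhds hr1] with s hs
      exact if_pos hs
    · have hr : a < ‖r‖ := ha1.trans_le (not_lt.1 hr1)
      refine (hdB r hr).congr_of_eventuallyEq ?_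
      filter_upwards [(isOpen_lt continuous_const continuous_norm).mem_nhds hr] with s hs
      exact hEB s hs
  obtain ⟨C₁, hC₁⟩ := (isCompact_closedBall (0 : ℂ) 1).exists_bound_of_continuousOn
    hdE.continuous.continuousOn
  obtain ⟨C₂, hC₂⟩ := (isCompact_closedBall (0 : ℂ) a).exists_bound_of_continuousOn
    (f := Φ) fun r hr => (hdΦ r (lt_of_le_of_lt (by simpa using hr) ha1)).continuousAt.continuousWithinAt
  have hb : Bornology.IsBounded (Set.range E) := by
    rw [isBounded_iff_forall_norm_le]
    refine ⟨max C₁ (2 * C₂), ?_⟩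
    rintro _ ⟨r, rfl⟩
    by_cases hr1 : ‖r‖ < 1
    · exact (hC₁ r (by simpa using hr1.le)).trans (le_max_left _ _)
    · refine le_trans ?_ (le_max_right _ _)
      have hr := not_lt.1 hr1
      rw [hEB r (ha1.trans_le hr), norm_mul]
      refine mul_le_mul ?_ (hC₂ _ ?_) (norm_nonneg _) zero_le_two
      · refine (norm_sub_le _ _).trans ?_
        have : ‖r‖⁻¹ ≤ 1 := inv_le_one_of_one_le₀ hr
        simp only [norm_one, one_div, norm_inv]
        linarith
      · simp only [mem_closedBall_zero_iff, norm_div, Complex.norm_real, Real.norm_of_nonneg ha.le]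
        exact div_le_self ha.le hr
  have hE0 : ∀ r, E r = 0 := by
    intro r
    rw [hdE.apply_eq_apply_of_bounded hb r a]
    have : ‖(a : ℂ)‖ < 1 := by simpa [abs_of_pos ha] using ha1
    simp only [hE, if_pos this, div_self haC]
    simp
  refine eq_zero_of_tsum_eventually_eq_zero hφ ?_
  filter_upwards [Metric.ball_mem_nhds (0 : ℂ) ha] with r hr
  have hr' : ‖r‖ < a := by simpa using hr
  have := hE0 r
  simp only [hE, if_pos (hr'.trans ha1), mul_eq_zero] at this
  refine this.resolve_left fun h1 => ?_
  have : r = a := by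
    field_simp at h1
    linear_combination -h1
  rw [this, Complex.norm_real, Real.norm_of_nonneg ha.le] at hr'
  exact lt_irrefl _ hr'

local notation "L1" => lp (fun _ : ℕ => ℂ) 1

theorem memℓp_one_iff {x : ℕ → ℂ} : Memℓp x 1 ↔ Summable fun i => ‖x i‖ := by
  simpa using memℓp_gen_iff (E := fun _ : ℕ => ℂ) (p := 1) (by simp) (f := x)

theorem summable_norm_lp_one (x : L1) : Summable fun i => ‖x i‖ := memℓp_one_iff.1 x.2

theorem norm_lp_one_eq (x : L1) : ‖x‖ = ∑' i, ‖x i‖ := by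
  simpa using lp.norm_eq_tsum_rpow (E := fun _ : ℕ => ℂ) (p := 1) (by simp) x

/-- The backward shift on `ℓ¹`. -/
noncomputable def backwardShift : L1 →L[ℂ] L1 :=
  LinearMap.mkContinuous
    { toFun := fun x => ⟨fun i => x (i + 1),
        memℓp_one_iff.2 ((summable_nat_add_iff 1).2 (summable_norm_lp_one x))⟩
      map_add' := fun x y => by ext i; rfl
      map_smul' := fun c x => by ext i; rfl } 1 (by
    intro x
    rw [one_mul, norm_lp_one_eq, norm_lp_one_eq, (summable_norm_lp_one x).tsum_eq_zero_add]
    exact le_add_of_nonneg_left (norm_nonneg _))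

@[simp] theorem backwardShift_apply (x : L1) (i : ℕ) : backwardShift x i = x (i + 1) := rfl

/-- The forward shift of sequences, inserting `0` at the beginning. -/
def shiftSeq (x : ℕ → ℂ) : ℕ → ℂ
  | 0 => 0
  | i + 1 => x i

theorem summable_norm_shiftSeq (x : L1) : Summable fun i => ‖shiftSeq x i‖ :=
  (summable_nat_add_iff 1).1 (summable_norm_lp_one x)

/-- The forward shift on `ℓ¹`. -/
noncomputable def forwardShift : L1 →L[ℂ] L1 :=
  LinearMap.mkContinuous
    { toFun := fun x => ⟨shiftSeq x, memℓp_one_iff.2 (summable_norm_shiftSeq x)⟩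
      map_add' := fun x y => by
        ext i
        cases i
        · exact (add_zero (0 : ℂ)).symm
        · rfl
      map_smul' := fun c x => by ext i; cases i <;> simp [shiftSeq] } 1 (by
    intro x
    rw [one_mul, norm_lp_one_eq, norm_lp_one_eq]
    refine ((summable_norm_shiftSeq x).tsum_eq_zero_add).le.trans ?_
    simp [shiftSeq])

@[simp] theorem forwardShift_zero (x : L1) : forwardShift x 0 = 0 := rfl

@[simp] theorem forwardShift_succ (x : L1) (i : ℕ) : forwardShift x (i + 1) = x i := rfl

theorem norm_forwardShift_le : ‖forwardShift‖ ≤ 1 :=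
  LinearMap.mkContinuous_norm_le _ zero_le_one _

/-- The transition operator `Wop p` as a bounded operator on `ℓ¹`. -/
noncomputable def walkCLM (p : ℝ) : L1 →L[ℂ] L1 :=
  (p : ℂ) • backwardShift + ((1 - p : ℝ) : ℂ) •
    (forwardShift + (lp.evalCLM ℂ (fun _ : ℕ => ℂ) 1 0).smulRight (lp.single 1 0 (1 : ℂ)))

theorem walkCLM_apply (p : ℝ) (x : L1) (i : ℕ) : walkCLM p x i = Wop p x i := by
  have h : walkCLM p x i = p * x (i + 1) +
      ((1 - p : ℝ) : ℂ) * (forwardShift x i + x 0 * lp.single (E := fun _ : ℕ => ℂ) 1 0 1 i) := rfl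
  rw [h]
  cases i <;> simp [Wop, lp.single_apply] <;> ring

theorem coe_walkCLM_pow (p : ℝ) (n : ℕ) (x : L1) :
    ((walkCLM p ^ n) x : ℕ → ℂ) = (Wop p)^[n] x := by
  induction n with
  | zero => simp
  | succ n ih =>
    rw [Function.iterate_succ_apply', ← ih, pow_succ']
    funext i
    exact walkCLM_apply p _ i

theorem exists_rightInverse_walkCLM {p : ℝ} (hp : 1 / 2 < p) (hp1 : p < 1) :
    ∃ R : L1 →L[ℂ] L1, (∀ x, walkCLM p (R x) = x) ∧ ∀ x, R x 0 = 0 := by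
  have hp0 : (p : ℂ) ≠ 0 := by exact_mod_cast (by linarith : p ≠ 0)
  set N : L1 →L[ℂ] L1 := -(((1 - p) / p : ℝ) : ℂ) • forwardShift ^ 2 with hN
  have ha : 0 ≤ (1 - p) / p := div_nonneg (by linarith) (by linarith)
  have hN1 : ‖N‖ < 1 := by
    calc ‖N‖ = (1 - p) / p * ‖forwardShift ^ 2‖ := by
          rw [hN, norm_smul, norm_neg, Complex.norm_real, Real.norm_of_nonneg ha]
      _ ≤ (1 - p) / p * 1 := by
          gcongr
          exact (norm_pow_le' _ two_pos).trans (pow_le_one₀ (norm_nonneg _) norm_forwardShift_le)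
      _ < 1 := by rw [mul_one, div_lt_one (by linarith)]; linarith
  obtain ⟨u, hu⟩ := isUnit_one_sub_of_norm_lt_one hN1
  have hux : ∀ x i, (u : L1 →L[ℂ] L1) x i =
      x i + (((1 - p) / p : ℝ) : ℂ) * forwardShift (forwardShift x) i := by
    intro x i
    rw [hu, hN, neg_smul, sub_neg_eq_add]
    rfl
  have hTS : ∀ x, walkCLM p (forwardShift x) = (p : ℂ) • (u : L1 →L[ℂ] L1) x := by
    intro x
    ext i
    rw [walkCLM_apply, lp.coeFn_smul, Pi.smul_apply, hux, smul_eq_mul]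
    rcases i with _ | _ | i <;> simp [Wop, forwardShift_succ _ 0]
    field_simp
    ring
  refine ⟨(p : ℂ)⁻¹ • (forwardShift * (↑u⁻¹ : L1 →L[ℂ] L1)), fun x => ?_, fun x => by simp⟩
  have : (u : L1 →L[ℂ] L1) ((↑u⁻¹ : L1 →L[ℂ] L1) x) = x := by
    rw [← mul_apply_eq_comp, Units.mul_inv]; rfl
  simp only [smul_apply, mul_apply_eq_comp, map_smul, hTS, this, inv_smul_smul₀ hp0]

/-- The eigenvector equation of the walk, in the parametrisation `p r + (1 - p) / r` of the
eigenvalue. -/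
theorem eigenvector_formula {p : ℝ} (hp : 0 < p) (hp1 : p < 1) {x : ℕ → ℂ} {r : ℂ} (hr : r ≠ 0)
    {a : ℝ} (ha : a = (1 - p) / p)
    (hx : ∀ i, Wop p x i = (p * r + ((1 - p : ℝ) : ℂ) / r) * x i) (h0 : x 0 = 1) (i : ℕ) :
    (1 / r - r / a) * x i = (1 - r / a) * r ^ i - (1 - 1 / r) * (a / r) ^ i := by
  have hpC : (p : ℂ) ≠ 0 := by exact_mod_cast hp.ne'
  have hqC : (1 - p : ℂ) ≠ 0 := by exact_mod_cast (by linarith : 1 - p ≠ 0)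
  have haC : (a : ℂ) = (1 - p) / p := by rw [ha]; push_cast; rfl
  have key : ∀ i, ((1 / r - r / a) * x i = (1 - r / a) * r ^ i - (1 - 1 / r) * (a / r) ^ i) ∧
      ((1 / r - r / a) * x (i + 1) =
        (1 - r / a) * r ^ (i + 1) - (1 - 1 / r) * (a / r) ^ (i + 1)) := by
    intro i
    induction i with
    | zero =>
      have h1 := hx 0
      simp only [Wop, if_true, h0] at h1
      have h2 : x 1 = (p * r + (1 - p) / r - (1 - p)) / p := by
        field_simp
        field_simp at h1
        push_cast at h1
        linear_combination h1
      refine ⟨by rw [h0]; ring, ?_⟩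
      rw [zero_add, h2, haC]
      field_simp
      ring
    | succ i ih =>
      refine ⟨ih.2, ?_⟩
      have h1 := hx (i + 1)
      simp only [Wop, Nat.succ_ne_zero, if_false, Nat.add_sub_cancel] at h1
      have h2 : x (i + 2) = (r + a / r) * x (i + 1) - a * x i := by
        rw [haC]
        field_simp
        field_simp at h1
        push_cast at h1
        linear_combination h1
      have haC0 : (a : ℂ) ≠ 0 := by rw [haC]; exact div_ne_zero hqC hpC
      calc (1 / r - r / a) * x (i + 2)
          = (r + a / r) * ((1 / r - r / a) * x (i + 1)) - a * ((1 / r - r / a) * x i) := by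
            rw [h2]; ring
        _ = _ := by
            rw [ih.1, ih.2]
            simp only [div_pow]
            field_simp
            ring
  exact (key i).1

theorem exists_eigenvector {X : Type*} [NormedAddCommGroup X] [NormedSpace ℂ X] [CompleteSpace X]
    {T R : X →L[ℂ] X} (hTR : ∀ x, T (R x) = x) {v : X} (hv : T v = 0) {c : ℂ}
    (hc : ‖c‖ * ‖R‖ < 1) : ∃ x, T x = c • x ∧ HasSum (fun k : ℕ => c ^ k • (R ^ k) v) x := by
  have hs : Summable fun k : ℕ => c ^ k • (R ^ k) v := by
    refine Summable.of_norm_bounded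
      ((summable_geometric_of_lt_one (by positivity) hc).mul_right ‖v‖) fun k => ?_
    rw [norm_smul, norm_pow, mul_pow, mul_assoc]
    gcongr
    refine ((R ^ k).le_opNorm v).trans ?_
    gcongr
    rcases k.eq_zero_or_pos with rfl | hk
    · rw [pow_zero, pow_zero]; exact ContinuousLinearMap.norm_id_le
    · exact norm_pow_le' _ hk
  refine ⟨_, ?_, hs.hasSum⟩
  rw [T.map_tsum hs, (T.summable hs).tsum_eq_zero_add, ← hs.tsum_const_smul]
  simp only [pow_zero, one_smul, map_smul]
  rw [show (1 : X →L[ℂ] X) v = v from rfl, hv, zero_add]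
  refine tsum_congr fun k => ?_
  rw [pow_succ' R, mul_apply_eq_comp, hTR, pow_succ', mul_smul]

theorem hasSum_dual_lp_one (f : L1 →L[ℂ] ℂ) (x : L1) :
    HasSum (fun i => f (lp.single 1 i (1 : ℂ)) * x i) (f x) := by
  have := (lp.hasSum_single (p := 1) (by simp) x).mapL f
  convert this using 1
  funext i
  have h : lp.single (E := fun _ : ℕ => ℂ) 1 i (x i) = x i • lp.single 1 i (1 : ℂ) := by
    rw [← lp.single_smul, smul_eq_mul, mul_one]
  rw [h, map_smul, smul_eq_mul, mul_comm]

theorem dense_span_generalizedKernel {p : ℝ} (hp : 1 / 2 < p) (hp1 : p < 1) {R : L1 →L[ℂ] L1}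
    (hTR : ∀ x, walkCLM p (R x) = x) (hR0 : ∀ x, R x 0 = 0) {v : L1} (hv : walkCLM p v = 0)
    (hv0 : v 0 = 1) :
    Dense (Submodule.span ℂ (Set.range fun k : ℕ => (R ^ k) v) : Set L1) := by
  refine Submodule.dense_of_forall_dual_eq_zero _ fun f hf => ?_
  have hf' : ∀ k : ℕ, f ((R ^ k) v) = 0 := fun k => hf _ (Submodule.subset_span ⟨k, rfl⟩)
  set φ : ℕ → ℂ := fun i => f (lp.single 1 i (1 : ℂ)) with hφdef
  have hφ : ∀ i, ‖φ i‖ ≤ ‖f‖ := fun i => by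
    simpa [lp.norm_single] using f.le_opNorm (lp.single 1 i (1 : ℂ))
  have hsum := hasSum_dual_lp_one f
  have hpow : ∀ {r : ℂ}, ‖r‖ < 1 → Summable fun i => φ i * r ^ i := fun {r} hr => by
    refine Summable.of_norm_bounded
      ((summable_geometric_of_lt_one (norm_nonneg r) hr).mul_left ‖f‖) fun i => ?_
    rw [norm_mul, norm_pow]
    gcongr
    exact hφ i
  obtain ⟨a, haeq⟩ : ∃ a : ℝ, a = (1 - p) / p := ⟨_, rfl⟩
  have ha : 0 < a := by rw [haeq]; exact div_pos (by linarith) (by linarith)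
  have ha1 : a < 1 := by rw [haeq, div_lt_one (by linarith)]; linarith
  set r₀ : ℂ := Complex.I * (√a : ℝ) with hr₀
  have hn : ‖r₀‖ = √a := by simp [hr₀, abs_of_nonneg (Real.sqrt_nonneg a)]
  have h₀ : a < ‖r₀‖ := by
    rw [hn]; exact Real.lt_sqrt_of_sq_lt (by nlinarith)
  have h₁ : ‖r₀‖ < 1 := by
    rw [hn, Real.sqrt_lt' one_pos]; simpa using ha1
  have hr0 : r₀ ≠ 0 := norm_pos_iff.1 (ha.trans h₀)
  have hpC : (p : ℂ) ≠ 0 := by exact_mod_cast (by linarith : p ≠ 0)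
  have hlam : (p * r₀ + ((1 - p : ℝ) : ℂ) / r₀ : ℂ) = 0 := by
    have h1 : r₀ ^ 2 = -(a : ℂ) := by
      rw [hr₀, mul_pow, Complex.I_sq, ← Complex.ofReal_pow, Real.sq_sqrt ha.le]; ring
    have h2 : (p : ℂ) * a = 1 - p := by rw [haeq]; push_cast; field_simp
    field_simp
    push_cast
    linear_combination p * h1 - h2
  have hev : ∀ᶠ r : ℂ in nhds r₀, ‖(p * r + ((1 - p : ℝ) : ℂ) / r : ℂ)‖ * ‖R‖ < 1 := by
    have hc : ContinuousAt (fun r : ℂ => ‖(p * r + ((1 - p : ℝ) : ℂ) / r : ℂ)‖ * ‖R‖) r₀ := by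
      fun_prop (disch := assumption)
    exact hc.eventually_lt continuousAt_const (by rw [hlam]; simp)
  have hφ0 : φ = 0 := by
    refine eq_zero_of_reflection_identity ha ha1 hφ h₀ h₁ ?_
    filter_upwards [hev, (isOpen_lt continuous_const continuous_norm).mem_nhds h₀,
      (isOpen_lt continuous_norm continuous_const).mem_nhds h₁] with r hr hra hr1
    have hrn : 0 < ‖r‖ := ha.trans hra
    obtain ⟨x, hTx, hx⟩ := exists_eigenvector hTR hv hr
    have hfx : f x = 0 := by
      have h := hx.mapL f
      simp only [map_smul, hf', smul_zero] at h
      exact h.unique hasSum_zero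
    have hx0 : x 0 = 1 := by
      refine (hx.mapL (lp.evalCLM ℂ (fun _ : ℕ => ℂ) 1 0)).unique ?_
      convert hasSum_single 0 fun k hk => ?_ using 1
      · simpa [lp.evalCLM] using hv0.symm
      · obtain ⟨k, rfl⟩ := Nat.exists_eq_succ_of_ne_zero hk
        rw [Nat.succ_eq_add_one, pow_succ' R]
        simp [lp.evalCLM, hR0]
    have hform := eigenvector_formula (by linarith) hp1 (norm_pos_iff.1 hrn) haeq
      (x := x) (fun i => by rw [← walkCLM_apply, hTx]; rfl) hx0
    have har : ‖(a : ℂ) / r‖ < 1 := by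
      rw [norm_div, Complex.norm_real, Real.norm_of_nonneg ha.le, div_lt_one hrn]; exact hra
    have h1 := (hsum x).mul_left (1 / r - r / a)
    rw [hfx, mul_zero] at h1
    have h2 := ((hpow hr1).hasSum.mul_left (1 - r / a)).sub
      ((hpow har).hasSum.mul_left (1 - 1 / r))
    have h3 : (fun i => (1 / r - r / a) * (f (lp.single 1 i (1 : ℂ)) * x i)) =
        fun i => (1 - r / a) * (φ i * r ^ i) - (1 - 1 / r) * (φ i * (a / r) ^ i) := by
      funext i
      linear_combination φ i * hform i
    rw [h3] at h1
    exact sub_eq_zero.1 (h2.unique h1)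
  ext x
  have h := hsum x
  simp only [show ∀ i, f (lp.single 1 i (1 : ℂ)) = 0 from fun i => congrFun hφ0 i, zero_mul] at h
  exact h.unique hasSum_zero

theorem exists_lp_one_supercyclic_walk {p : ℝ} (hp : 1 / 2 < p) (hp1 : p < 1) :
    ∃ x : L1, ∀ z : L1, ∀ ε : ℝ, 0 < ε →
      ∃ (c : ℂ) (n : ℕ), ‖c • (walkCLM p ^ n) x - z‖ < ε := by
  obtain ⟨R, hTR, hR0⟩ := exists_rightInverse_walkCLM hp hp1
  set e : L1 := lp.single 1 0 (1 : ℂ)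
  set v : L1 := e - R (walkCLM p e) with hvdef
  have hv : walkCLM p v = 0 := by rw [hvdef, map_sub, hTR, sub_self]
  have hv0 : v 0 = 1 := by simp [hvdef, hR0, e]
  have hd := dense_span_generalizedKernel hp hp1 hTR hR0 hv hv0
  have : TopologicalSpace.SeparableSpace L1 := by
    rw [← TopologicalSpace.isSeparable_univ_iff, ← hd.closure_eq]
    exact (TopologicalSpace.IsSeparable.span (Set.countable_range _).isSeparable).closure
  refine exists_dense_projective_orbit (walkCLM p) R hTR (hd.mono fun x hx => ?_)
  have hk : ∀ k : ℕ, (walkCLM p ^ (k + 1)) ((R ^ k) v) = 0 := by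
    intro k
    induction k with
    | zero => simpa using hv
    | succ k ih =>
      rw [pow_succ, pow_succ' R]
      simpa [hTR] using ih
  induction hx using Submodule.span_induction with
  | mem x hx => obtain ⟨k, rfl⟩ := hx; exact ⟨k + 1, hk k⟩
  | zero => exact ⟨0, by simp⟩
  | add x y _ _ hx hy =>
    obtain ⟨m, hm⟩ := hx
    obtain ⟨n, hn⟩ := hy
    refine ⟨m + n, ?_⟩
    have h1 : (walkCLM p ^ (m + n)) x = 0 := by
      rw [add_comm, pow_add, mul_apply_eq_comp, hm, map_zero]
    have h2 : (walkCLM p ^ (m + n)) y = 0 := by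
      rw [pow_add, mul_apply_eq_comp, hn, map_zero]
    rw [map_add, h1, h2, add_zero]
  | smul c x _ hx =>
    obtain ⟨n, hn⟩ := hx
    exact ⟨n, by rw [map_smul, hn, smul_zero]⟩

/-- Truncation of a sequence to its first `N` terms, as an element of `ℓ¹`. -/
theorem exists_lp_one_truncation (z : ℕ → ℂ) (N : ℕ) :
    ∃ w : L1, (∀ i < N, w i = z i) ∧ ∀ i, N ≤ i → w i = 0 := by
  refine ⟨⟨fun i => if i < N then z i else 0, memℓp_one_iff.2 ?_⟩, fun i hi => if_pos hi,
    fun i hi => if_neg (not_lt.2 hi)⟩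
  exact summable_of_ne_finset_zero (s := Finset.range N) fun i hi => by
    simp [if_neg (Finset.mem_range.not.1 hi)]

/-- For `p ∈ (1/2, 1)`, the transition operator `W_p` of the simple random walk on `ℤ₊`
is supercyclic on `c₀` and on every `ℓ^q`, `q ≥ 1`. -/
theorem stmt6 (p : ℝ) (hp : 1/2 < p) (hp1 : p < 1) :
    SupercyclicOn memc0 distC0lt (Wop p) ∧
    ∀ q : ℝ, 1 ≤ q → SupercyclicOn (memlq q) (distLqlt q) (Wop p) := by
  obtain ⟨x, hx⟩ := exists_lp_one_supercyclic_walk hp hp1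
  have hxs := summable_norm_lp_one x
  have hx0 : Tendsto (fun i => x i) atTop (nhds 0) :=
    tendsto_zero_iff_norm_tendsto_zero.2 hxs.tendsto_atTop_zero
  refine ⟨⟨x, hx0, fun z hz ε hε => ?_⟩, fun q hq => ⟨x, ?_, fun z hz ε hε => ?_⟩⟩
  · obtain ⟨N, hN⟩ := Metric.tendsto_atTop.1 hz (ε / 2) (half_pos hε)
    obtain ⟨w, hw, hw'⟩ := exists_lp_one_truncation z N
    obtain ⟨c, n, hcn⟩ := hx w (ε / 2) (half_pos hε)
    refine ⟨c, n, fun i => ?_⟩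
    have h1 : ‖c * (Wop p)^[n] x i - w i‖ < ε / 2 := by
      rw [← coe_walkCLM_pow]
      exact (lp.norm_apply_le_norm one_ne_zero (c • (walkCLM p ^ n) x - w) i).trans_lt hcn
    have h2 : ‖w i - z i‖ < ε / 2 := by
      by_cases hi : i < N
      · rw [hw i hi, sub_self, norm_zero]; exact half_pos hε
      · rw [hw' i (not_lt.1 hi), ← dist_eq_norm, dist_comm]; exact hN i (not_lt.1 hi)
    calc _ ≤ _ := norm_sub_le_norm_sub_add_norm_sub _ (w i) _
      _ < ε := by linarith
  · have hq0 : (0 : ℝ) ≤ q := by linarith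
    have hm : Memℓp (x : ℕ → ℂ) (ENNReal.ofReal q) :=
      x.2.of_exponent_ge (ENNReal.one_le_ofReal.2 hq)
    have := (memℓp_gen_iff (by rw [ENNReal.toReal_ofReal hq0]; linarith)).1 hm
    rwa [ENNReal.toReal_ofReal hq0] at this
  · have hq0 : (0 : ℝ) < q := by linarith
    have hC : (0 : ℝ) < 2 ^ (q - 1) := by positivity
    set δ : ℝ := ε / (2 * 2 ^ (q - 1)) with hδ
    have hδ0 : 0 < δ := by positivity
    obtain ⟨N, hN⟩ := ((tendsto_sum_nat_add fun i => ‖z i‖ ^ q).eventually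
      (gt_mem_nhds hδ0)).exists
    obtain ⟨w, hw, hw'⟩ := exists_lp_one_truncation z N
    obtain ⟨c, n, hcn⟩ := hx w (min 1 δ) (lt_min one_pos hδ0)
    refine ⟨c, n, ?_⟩
    set d : L1 := c • (walkCLM p ^ n) x - w with hd
    have hdi : ∀ i, c * (Wop p)^[n] x i - w i = d i := fun i => by
      rw [← coe_walkCLM_pow]; rfl
    have hds := summable_norm_lp_one d
    have hdq : ∀ i, ‖d i‖ ^ q ≤ ‖d i‖ := fun i =>
      Real.rpow_le_self_of_le_one (norm_nonneg _)
        ((lp.norm_apply_le_norm one_ne_zero d i).trans (hcn.le.trans (min_le_left _ _))) hq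
    have hwz : ∀ i, ‖w i - z i‖ ^ q = if i < N then 0 else ‖z i‖ ^ q := fun i => by
      by_cases hi : i < N
      · simp [hw i hi, hi, hq0.ne']
      · simp [hw' i (not_lt.1 hi), hi]
    have hz' : Summable fun i => ‖z i‖ ^ q := hz
    have hwzs : HasSum (fun i => ‖w i - z i‖ ^ q) (∑' i, ‖z (i + N)‖ ^ q) := by
      have h1 : HasSum (fun i => ‖w (i + N) - z (i + N)‖ ^ q) (∑' i, ‖z (i + N)‖ ^ q) := by
        simpa [hwz] using ((summable_nat_add_iff N).2 hz').hasSum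
      have h2 := (hasSum_nat_add_iff (f := fun i => ‖w i - z i‖ ^ q) N).1 h1
      rwa [Finset.sum_eq_zero fun i hi => by rw [hwz, if_pos (Finset.mem_range.1 hi)],
        add_zero] at h2
    have hle : ∀ i, ‖c * (Wop p)^[n] x i - z i‖ ^ q ≤
        2 ^ (q - 1) * (‖d i‖ + ‖w i - z i‖ ^ q) := fun i => by
      have h1 : ‖c * (Wop p)^[n] x i - z i‖ ≤ ‖d i‖ + ‖w i - z i‖ := by
        rw [← hdi]; exact norm_sub_le_norm_sub_add_norm_sub _ _ _
      have h2 : (‖d i‖ + ‖w i - z i‖) ^ q ≤ 2 ^ (q - 1) * (‖d i‖ ^ q + ‖w i - z i‖ ^ q) := by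
        exact_mod_cast NNReal.rpow_add_le_mul_rpow_add_rpow ‖d i‖₊ ‖w i - z i‖₊ hq
      refine (Real.rpow_le_rpow (norm_nonneg _) h1 hq0.le).trans (h2.trans ?_)
      gcongr
      exact hdq i
    have hs := (hds.hasSum.add hwzs).mul_left ((2 : ℝ) ^ (q - 1))
    have hlt : (∑' i, ‖d i‖) + (∑' i, ‖z (i + N)‖ ^ q) < 2 * δ := by
      rw [← norm_lp_one_eq]
      have := hcn.trans_le (min_le_right _ _)
      linarith
    calc (∑' i, ‖c * (Wop p)^[n] x i - z i‖ ^ q)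
        ≤ 2 ^ (q - 1) * ((∑' i, ‖d i‖) + ∑' i, ‖z (i + N)‖ ^ q) := by
          rw [← hs.tsum_eq]
          exact (Summable.of_nonneg_of_le (fun i => by positivity) hle hs.summable).tsum_le_tsum
            hle hs.summable
      _ < 2 ^ (q - 1) * (2 * δ) := by gcongr
      _ = ε := by rw [hδ]; field_simp
end

section
/- Let p ∈ (1/2, 1), let X be c_0 or l^q for some q ≥ 1, and let λ ∈ ℂ with |λ| > 1/(2p−1). Then the operator λ W_p is frequently hypercyclic on X. -/
open Filter

/-- A set of natural numbers has positive lower density. -/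
def HasPosLowerDensity (A : Set ℕ) : Prop :=
  ∃ c : ℝ, 0 < c ∧ ∀ᶠ N : ℕ in atTop, c * N ≤ ((A ∩ Set.Icc 1 N).ncard : ℝ)

theorem HasPosLowerDensity.mono {A B : Set ℕ} (hA : HasPosLowerDensity A) (h : A ⊆ B) :
    HasPosLowerDensity B := by
  obtain ⟨c, hc, hN⟩ := hA
  refine ⟨c, hc, hN.mono fun N hN => hN.trans ?_⟩
  exact_mod_cast Set.ncard_le_ncard (Set.inter_subset_inter_left _ h)
    ((Set.finite_Icc 1 N).inter_of_right _)

theorem HasPosLowerDensity.liminf_pos {A : Set ℕ} (hA : HasPosLowerDensity A) :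
    0 < liminf (fun N : ℕ => ((A ∩ Set.Icc 1 N).ncard : ℝ) / (N : ℝ)) atTop := by
  obtain ⟨c, hc, hN⟩ := hA
  refine hc.trans_le (le_liminf_of_le ?_ ?_)
  · refine IsBoundedUnder.isCoboundedUnder_ge ⟨1, ?_⟩
    refine eventually_map.2 (Eventually.of_forall fun N => ?_)
    refine div_le_one_of_le₀ ?_ (Nat.cast_nonneg N)
    have h := Set.ncard_le_ncard (Set.inter_subset_right (s := A) (t := Set.Icc 1 N))
      (Set.finite_Icc 1 N)
    have h2 : (Set.Icc 1 N).ncard = N := by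
      rw [← Nat.card_coe_set_eq]; simp
    exact_mod_cast h.trans h2.le
  · filter_upwards [hN, eventually_gt_atTop 0] with N h hpos
    rwa [le_div_iff₀ (by exact_mod_cast hpos)]

/-- The colour of `i`: the exponent of `2` in `i + 1`. -/
def rulerColor (i : ℕ) : ℕ := padicValNat 2 (i + 1)

/-- Times `spreadTime 0 < spreadTime 1 < ⋯`, of linear growth, such that the gap between
two of them is at least the sum of their colours. -/
def spreadTime (i : ℕ) : ℕ :=
  padicValNat 2 (i + 1).factorial + padicValNat 2 i.factorial + (i + 1)

theorem padicValNat_two_factorial_succ (i : ℕ) :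
    padicValNat 2 (i + 1).factorial = rulerColor i + padicValNat 2 i.factorial := by
  rw [Nat.factorial_succ, padicValNat.mul (by omega) (Nat.factorial_ne_zero i), rulerColor]

theorem spreadTime_succ (i : ℕ) :
    spreadTime (i + 1) = spreadTime i + rulerColor i + rulerColor (i + 1) + 1 := by
  have h1 := padicValNat_two_factorial_succ i
  have h2 := padicValNat_two_factorial_succ (i + 1)
  simp only [spreadTime]
  omega

theorem spreadTime_gap {i j : ℕ} (h : i < j) :
    spreadTime i + rulerColor i + rulerColor j + (j - i) ≤ spreadTime j := by
  induction j, h using Nat.le_induction with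
  | base => rw [Nat.succ_eq_add_one, spreadTime_succ]; omega
  | succ j hj ih => rw [spreadTime_succ]; omega

theorem spreadTime_strictMono : StrictMono spreadTime := fun i j h => by
  have := spreadTime_gap h
  omega

theorem add_rulerColor_le_two_mul_spreadTime (i : ℕ) : i + rulerColor i ≤ 2 * spreadTime i := by
  have := padicValNat_two_factorial_succ i
  simp only [spreadTime]
  omega

theorem spreadTime_le (i : ℕ) : spreadTime i ≤ 3 * (i + 1) := by
  have h (n : ℕ) : padicValNat 2 n.factorial ≤ n := by
    have := sub_one_mul_padicValNat_factorial (p := 2) n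
    omega
  have h1 := h i
  have h2 := h (i + 1)
  simp only [spreadTime]
  omega

theorem hasPosLowerDensity_spreadTime (k : ℕ) :
    HasPosLowerDensity (spreadTime '' {i | rulerColor i = k}) := by
  set a : ℕ := 6 * 2 ^ k with ha
  have hk : 0 < 2 ^ k := by positivity
  have ha0 : 0 < a := by positivity
  refine ⟨1 / (2 * a), by positivity, ?_⟩
  filter_upwards [eventually_ge_atTop a] with N hN
  let f : ℕ → ℕ := fun m => spreadTime (2 ^ k * (2 * m + 1) - 1)
  have hidx (m : ℕ) : 2 ^ k * (2 * m + 1) - 1 + 1 = 2 ^ k * (2 * m + 1) :=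
    Nat.sub_add_cancel (Nat.mul_pos hk (by omega))
  have hf : Function.Injective f := by
    intro m m' h
    have h1 := spreadTime_strictMono.injective h
    have h2 : 2 ^ k * (2 * m + 1) = 2 ^ k * (2 * m' + 1) := by
      rw [← hidx m, ← hidx m', h1]
    have := Nat.eq_of_mul_eq_mul_left hk h2
    omega
  have hsub : f '' Set.Iio (N / a) ⊆
      spreadTime '' {i | rulerColor i = k} ∩ Set.Icc 1 N := by
    rintro _ ⟨m, hm, rfl⟩
    refine ⟨⟨_, ?_, rfl⟩, ?_, ?_⟩
    · change padicValNat 2 _ = k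
      rw [hidx, padicValNat.mul (by positivity) (by omega), padicValNat.prime_pow,
        padicValNat.eq_zero_of_not_dvd (by omega), add_zero]
    · simp only [f, spreadTime]; omega
    · refine (spreadTime_le _).trans ?_
      rw [hidx]
      have h1 : a * (m + 1) ≤ N :=
        (Nat.mul_le_mul_left a (Nat.succ_le_of_lt hm)).trans (Nat.mul_div_le N a)
      refine le_trans ?_ h1
      rw [ha]
      nlinarith
  have hcard : N / a ≤ (spreadTime '' {i | rulerColor i = k} ∩ Set.Icc 1 N).ncard := by
    have := Set.ncard_le_ncard hsub ((Set.finite_Icc 1 N).inter_of_right _)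
    rw [Set.ncard_image_of_injective _ hf] at this
    rw [← Nat.card_coe_set_eq] at this
    simpa using this
  have hdiv : N ≤ 2 * a * (N / a) := by
    have h1 := Nat.div_add_mod N a
    have h2 := Nat.mod_lt N ha0
    have h3 : 1 ≤ N / a := (Nat.one_le_div_iff ha0).2 hN
    nlinarith
  have : (N : ℝ) ≤ 2 * a * ((N / a : ℕ) : ℝ) := by exact_mod_cast hdiv
  calc 1 / (2 * (a : ℝ)) * N ≤ 1 / (2 * (a : ℝ)) * (2 * a * ((N / a : ℕ) : ℝ)) := by gcongr
    _ = ((N / a : ℕ) : ℝ) := by field_simp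
    _ ≤ _ := by exact_mod_cast hcard

theorem exists_dense_orbit_of_dense_ker {X : Type*} [NormedAddCommGroup X] [NormedSpace ℂ X]
    [CompleteSpace X] [TopologicalSpace.SeparableSpace X] (T S : X →L[ℂ] X) (hTS : T * S = 1)
    (hS : ‖S‖ < 1) (hD : Dense {x | ∃ n : ℕ, (T ^ n) x = 0}) :
    ∃ x : X, ∀ z : X, ∀ ε : ℝ, 0 < ε → HasPosLowerDensity {n : ℕ | ‖(T ^ n) x - z‖ < ε} := by
  obtain ⟨t, htD, htc, htd⟩ := hD.exists_countable_dense_subset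
  obtain ⟨d, rfl⟩ := htc.exists_eq_range htd.nonempty
  have hdD : ∀ k, ∃ n : ℕ, (T ^ n) (d k) = 0 := fun k => htD ⟨k, rfl⟩
  choose m hm using hdD
  obtain ⟨a, haS, ha1⟩ := exists_between hS
  have ha0 : 0 < a := (norm_nonneg S).trans_lt haS
  set ρ : ℝ := √a with hρ
  have hρ0 : 0 < ρ := Real.sqrt_pos.2 ha0
  have hρ1 : ρ < 1 := by rw [hρ, Real.sqrt_lt' one_pos]; simpa using ha1
  have hρS : ‖S‖ ≤ ρ ^ 2 := by rw [hρ, Real.sq_sqrt ha0.le]; exact haS.le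
  have hSpow (n : ℕ) (v : X) : ‖(S ^ n) v‖ ≤ ρ ^ (2 * n) * ‖v‖ := by
    refine ((S ^ n).le_opNorm v).trans (mul_le_mul_of_nonneg_right ?_ (norm_nonneg v))
    rw [pow_mul]
    obtain rfl | hn := Nat.eq_zero_or_pos n
    · rw [pow_zero, pow_zero]
      exact ContinuousLinearMap.norm_id_le
    · exact (norm_pow_le' S hn).trans (pow_le_pow_left₀ (norm_nonneg S) hρS n)
  have hTSn (n : ℕ) : T ^ n * S ^ n = 1 := by
    induction n with
    | zero => simp
    | succ n ih => rw [pow_succ, pow_succ', mul_assoc, ← mul_assoc T, hTS, one_mul, ih]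
  have hpow_add (A : X →L[ℂ] X) (k l : ℕ) (v : X) : (A ^ (k + l)) v = (A ^ k) ((A ^ l) v) := by
    rw [pow_add]; rfl
  have hTSv (n : ℕ) (v : X) : (T ^ n) ((S ^ n) v) = v := by
    change (T ^ n * S ^ n) v = v
    rw [hTSn]; rfl
  classical
  let y : ℕ → X := fun l =>
    if m l.unpair.1 ≤ l ∧ ρ ^ l * ‖d l.unpair.1‖ ≤ 1 then d l.unpair.1 else 0
  have hy1 (l : ℕ) : ρ ^ l * ‖y l‖ ≤ 1 := by
    simp only [y]; split_ifs with h
    · exact h.2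
    · simp
  have hy2 (l n : ℕ) (h : l ≤ n) : (T ^ n) (y l) = 0 := by
    simp only [y]; split_ifs with h'
    · rw [← Nat.sub_add_cancel (h'.1.trans h), hpow_add, hm, map_zero]
    · simp
  let u : ℕ → X := fun i => (S ^ spreadTime i) (y (rulerColor i))
  have hu (i : ℕ) : ‖u i‖ ≤ ρ ^ i := by
    calc ‖u i‖ ≤ ρ ^ (2 * spreadTime i) * ‖y (rulerColor i)‖ := hSpow _ _
      _ ≤ ρ ^ (i + rulerColor i) * ‖y (rulerColor i)‖ := by
        refine mul_le_mul_of_nonneg_right ?_ (norm_nonneg _)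
        exact pow_le_pow_of_le_one hρ0.le hρ1.le (add_rulerColor_le_two_mul_spreadTime i)
      _ = ρ ^ i * (ρ ^ rulerColor i * ‖y (rulerColor i)‖) := by ring
      _ ≤ ρ ^ i * 1 := by gcongr; exact hy1 _
      _ = ρ ^ i := mul_one _
  have hgeo := summable_geometric_of_lt_one hρ0.le hρ1
  have husum : Summable u := Summable.of_norm_bounded hgeo hu
  have hmain (i : ℕ) : ‖(T ^ spreadTime i) (∑' j, u j) - y (rulerColor i)‖ ≤
      ρ ^ rulerColor i * (1 - ρ)⁻¹ := by
    set n := spreadTime i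
    have hTu : Summable fun j => (T ^ n) (u j) := (T ^ n).summable husum
    rw [(T ^ n).map_tsum husum, ← hTu.sum_add_tsum_nat_add (i + 1), Finset.sum_range_succ]
    have h0 : ∑ j ∈ Finset.range i, (T ^ n) (u j) = 0 := by
      refine Finset.sum_eq_zero fun j hj => ?_
      have hg := spreadTime_gap (Finset.mem_range.1 hj)
      have hn : n = (n - spreadTime j) + spreadTime j := by omega
      simp only [u]
      rw [hn, hpow_add, hTSv]
      exact hy2 _ _ (by omega)
    have hi : (T ^ n) (u i) = y (rulerColor i) := hTSv _ _
    rw [h0, hi, zero_add, add_sub_cancel_left, ← tsum_geometric_of_lt_one hρ0.le hρ1,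
      ← tsum_mul_left]
    refine tsum_of_norm_bounded (hgeo.mul_left _).hasSum fun j => ?_
    have hg := spreadTime_gap (show i < j + (i + 1) by omega)
    set i' := j + (i + 1)
    have hn : spreadTime i' = n + (spreadTime i' - n) := by omega
    simp only [u]
    rw [hn, hpow_add, hTSv]
    calc _ ≤ ρ ^ (2 * (spreadTime i' - n)) * ‖y (rulerColor i')‖ := hSpow _ _
      _ ≤ ρ ^ (rulerColor i + j + rulerColor i') * ‖y (rulerColor i')‖ := by
        refine mul_le_mul_of_nonneg_right ?_ (norm_nonneg _)
        exact pow_le_pow_of_le_one hρ0.le hρ1.le (by omega)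
      _ = ρ ^ rulerColor i * ρ ^ j * (ρ ^ rulerColor i' * ‖y (rulerColor i')‖) := by ring
      _ ≤ ρ ^ rulerColor i * ρ ^ j * 1 := by gcongr; exact hy1 _
      _ = _ := mul_one _
  refine ⟨∑' j, u j, fun z ε hε => ?_⟩
  obtain ⟨_, ⟨k, rfl⟩, hk⟩ := Metric.dense_iff.1 htd z (ε / 2) (half_pos hε) |>.imp fun _ h => h.symm
  have hpow0 := tendsto_pow_atTop_nhds_zero_of_lt_one hρ0.le hρ1
  have e1 : ∀ᶠ l : ℕ in atTop, ρ ^ l * ‖d k‖ ≤ 1 := by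
    have := hpow0.mul_const ‖d k‖
    rw [zero_mul] at this
    exact this.eventually_le_const one_pos
  have e2 : ∀ᶠ l : ℕ in atTop, ρ ^ l * (1 - ρ)⁻¹ < ε / 2 := by
    have := hpow0.mul_const (1 - ρ)⁻¹
    rw [zero_mul] at this
    exact this.eventually_lt_const (half_pos hε)
  obtain ⟨L, hL⟩ := eventually_atTop.1 (e1.and (e2.and (eventually_ge_atTop (m k))))
  obtain ⟨h1, h2, h3⟩ := hL _ (Nat.right_le_pair k L)
  set l := Nat.pair k L with hl
  have hyl : y l = d k := by
    have hk : l.unpair.1 = k := by rw [hl, Nat.unpair_pair]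
    simp only [y, hk]
    rw [if_pos ⟨h3, h1⟩]
  refine (hasPosLowerDensity_spreadTime l).mono ?_
  rintro _ ⟨i, hi, rfl⟩
  have hi' : rulerColor i = l := hi
  have h4 := hmain i
  rw [hi', hyl] at h4
  have h5 : ‖d k - z‖ < ε / 2 := by rw [← dist_eq_norm]; exact hk
  calc _ ≤ ‖(T ^ spreadTime i) (∑' j, u j) - d k‖ + ‖d k - z‖ := norm_sub_le_norm_sub_add_norm_sub _ _ _
    _ < ε / 2 + ε / 2 := add_lt_add (h4.trans_lt h2) h5
    _ = ε := add_halves ε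

/-- The Banach space of summable complex sequences. -/
abbrev SummableSeq : Type := lp (fun _ : ℕ => ℂ) 1

namespace SummableSeq

theorem summable_norm (x : SummableSeq) : Summable fun i => ‖x i‖ := by
  simpa using (lp.memℓp x).summable (by simp)

theorem norm_eq_tsum (x : SummableSeq) : ‖x‖ = ∑' i, ‖x i‖ := by
  simpa using lp.norm_eq_tsum_rpow (p := 1) (by simp) x

/-- The element of `ℓ¹` given by an absolutely summable sequence. -/
def ofSummable (f : ℕ → ℂ) (hf : Summable fun i => ‖f i‖) : SummableSeq :=
  ⟨f, memℓp_gen (by simpa using hf)⟩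

theorem ofSummable_apply (f : ℕ → ℂ) (hf : Summable fun i => ‖f i‖) (i : ℕ) :
    ofSummable f hf i = f i := rfl

/-- The linear operator on `ℓ¹` given by `x ↦ f x`, provided it is contractive. -/
noncomputable def mkContraction (f : (ℕ → ℂ) →ₗ[ℂ] (ℕ → ℂ))
    (hf : ∀ x : SummableSeq, Summable (fun i => ‖f x i‖) ∧ ∑' i, ‖f x i‖ ≤ ∑' i, ‖x i‖) :
    SummableSeq →L[ℂ] SummableSeq :=
  LinearMap.mkContinuous
    { toFun := fun x => ofSummable (f x) (hf x).1
      map_add' := fun x y => lp.ext (by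
        funext i
        simp only [lp.coeFn_add, Pi.add_apply, ofSummable_apply, map_add])
      map_smul' := fun c x => lp.ext (by
        funext i
        simp only [lp.coeFn_smul, Pi.smul_apply, ofSummable_apply, map_smul, RingHom.id_apply]) }
    1 (fun x => by
      rw [one_mul, norm_eq_tsum, norm_eq_tsum]
      exact (hf x).2)

theorem norm_mkContraction_le (f : (ℕ → ℂ) →ₗ[ℂ] (ℕ → ℂ)) (hf) : ‖mkContraction f hf‖ ≤ 1 :=
  LinearMap.mkContinuous_norm_le _ zero_le_one _

/-- The backward shift `(x₀, x₁, …) ↦ (x₁, x₂, …)`. -/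
noncomputable def backwardShift : SummableSeq →L[ℂ] SummableSeq :=
  mkContraction (LinearMap.funLeft ℂ ℂ Nat.succ) fun x => by
    have h := (summable_nat_add_iff 1).2 x.summable_norm
    refine ⟨h, ?_⟩
    rw [x.summable_norm.tsum_eq_zero_add]
    exact le_add_of_nonneg_left (norm_nonneg _)

/-- The forward shift `(x₀, x₁, …) ↦ (0, x₀, x₁, …)`. -/
noncomputable def forwardShift : SummableSeq →L[ℂ] SummableSeq :=
  mkContraction
    { toFun := fun x i => Nat.casesOn i 0 x
      map_add' := fun x y => by funext i; cases i <;> simp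
      map_smul' := fun c x => by funext i; cases i <;> simp } fun x => by
    have h : Summable fun i : ℕ => ‖(Nat.casesOn i 0 x : ℂ)‖ :=
      (summable_nat_add_iff 1).1 x.summable_norm
    refine ⟨h, ?_⟩
    change ∑' i : ℕ, ‖(Nat.casesOn i 0 x : ℂ)‖ ≤ _
    rw [h.tsum_eq_zero_add]
    simp

theorem forwardShift_zero (x : SummableSeq) : forwardShift x 0 = 0 := rfl

theorem forwardShift_succ (x : SummableSeq) (i : ℕ) : forwardShift x (i + 1) = x i := rfl

theorem norm_forwardShift_le : ‖forwardShift‖ ≤ 1 := norm_mkContraction_le _ _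

/-- The projection `x ↦ x₀ e₀`. -/
noncomputable def headProj : SummableSeq →L[ℂ] SummableSeq :=
  (lp.singleContinuousLinearMap ℂ (fun _ : ℕ => ℂ) 1 0).comp
    (lp.evalCLM ℂ (fun _ : ℕ => ℂ) 1 0)

theorem headProj_apply (x : SummableSeq) : headProj x = lp.single 1 0 (x 0) := rfl

/-- The operator `W_p` on `ℓ¹`. -/
noncomputable def walkOp (p : ℝ) : SummableSeq →L[ℂ] SummableSeq :=
  (p : ℂ) • backwardShift + ((1 - p : ℝ) : ℂ) • (forwardShift + headProj)

theorem coe_walkOp (p : ℝ) (x : SummableSeq) : ⇑(walkOp p x) = Wop p x := by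
  funext i
  have h : walkOp p x i = (p : ℂ) * x (i + 1) +
    ((1 - p : ℝ) : ℂ) * (forwardShift x i + (lp.single 1 0 (x 0) : SummableSeq) i) := rfl
  rw [h, Wop]
  cases i with
  | zero => simp [forwardShift_zero, add_comm]
  | succ i => simp [forwardShift_succ, add_comm]

/-- A right inverse of `W_p` on `ℓ¹`. -/
noncomputable def walkInv (p : ℝ) : SummableSeq →L[ℂ] SummableSeq :=
  ((p : ℂ)⁻¹) • (forwardShift * ∑' n : ℕ, (-((((1 - p) / p : ℝ) : ℂ) • forwardShift ^ 2)) ^ n)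

theorem norm_smul_forwardShift_sq_le {p : ℝ} (hp : 1 / 2 < p) (hp1 : p < 1) :
    ‖-((((1 - p) / p : ℝ) : ℂ) • forwardShift ^ 2)‖ ≤ (1 - p) / p := by
  have hβ : 0 ≤ (1 - p) / p := div_nonneg (by linarith) (by linarith)
  rw [norm_neg, norm_smul, Complex.norm_real, Real.norm_of_nonneg hβ]
  refine mul_le_of_le_one_right hβ ((norm_pow_le' _ two_pos).trans ?_)
  exact pow_le_one₀ (norm_nonneg _) norm_forwardShift_le

theorem one_sub_div_lt_one {p : ℝ} (hp : 1 / 2 < p) : (1 - p) / p < 1 := by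
  rw [div_lt_one (by linarith)]; linarith

theorem walkOp_mul_walkInv {p : ℝ} (hp : 1 / 2 < p) (hp1 : p < 1) :
    walkOp p * walkInv p = 1 := by
  have hBF : backwardShift * forwardShift = 1 := by
    ext x i; rfl
  have hHF : headProj * forwardShift = 0 := by
    refine ContinuousLinearMap.ext fun x => ?_
    change headProj (forwardShift x) = 0
    rw [headProj_apply, forwardShift_zero, lp.single_zero]
  have hp0 : (p : ℂ) ≠ 0 := by exact_mod_cast (by linarith : p ≠ 0)
  have hWF : walkOp p * forwardShift =
      (p : ℂ) • (1 - -((((1 - p) / p : ℝ) : ℂ) • forwardShift ^ 2)) := by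
    rw [walkOp, add_mul, smul_mul_assoc, smul_mul_assoc, add_mul, hBF, hHF, add_zero,
      sub_neg_eq_add, smul_add, smul_smul, sq]
    congr 2
    push_cast
    field_simp
  have hlt := (norm_smul_forwardShift_sq_le hp hp1).trans_lt (one_sub_div_lt_one hp)
  rw [walkInv, mul_smul_comm, ← mul_assoc, hWF, smul_mul_assoc, mul_neg_geom_series _ hlt,
    smul_smul, inv_mul_cancel₀ hp0, one_smul]

theorem norm_walkInv_le {p : ℝ} (hp : 1 / 2 < p) (hp1 : p < 1) :
    ‖walkInv p‖ ≤ 1 / (2 * p - 1) := by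
  have hp0 : 0 < p := by linarith
  have hle := norm_smul_forwardShift_sq_le hp hp1
  have hβ := one_sub_div_lt_one hp
  have hone : ‖(1 : SummableSeq →L[ℂ] SummableSeq)‖ ≤ 1 := ContinuousLinearMap.norm_id_le
  have h1 : ‖∑' n : ℕ, (-((((1 - p) / p : ℝ) : ℂ) • forwardShift ^ 2)) ^ n‖ ≤
      (1 - (1 - p) / p)⁻¹ := by
    refine (tsum_geometric_le_of_norm_lt_one _ (hle.trans_lt hβ)).trans ?_
    have : (1 - ‖-((((1 - p) / p : ℝ) : ℂ) • forwardShift ^ 2)‖)⁻¹ ≤ (1 - (1 - p) / p)⁻¹ :=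
      inv_anti₀ (by linarith) (by linarith)
    linarith
  rw [walkInv, norm_smul, norm_inv, Complex.norm_real, Real.norm_of_nonneg hp0.le]
  calc _ ≤ p⁻¹ * (1 * (1 - (1 - p) / p)⁻¹) := by
        gcongr
        exact (norm_mul_le _ _).trans
          (mul_le_mul norm_forwardShift_le h1 (norm_nonneg _) zero_le_one)
    _ = 1 / (2 * p - 1) := by
        have : 2 * p - 1 ≠ 0 := by linarith
        have h2 : 1 - (1 - p) / p = (2 * p - 1) / p := by field_simp; ring
        rw [h2]
        field_simp

end SummableSeq

theorem Submodule.dense_of_forall_dual {X : Type*} [NormedAddCommGroup X] [NormedSpace ℂ X]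
    (V : Submodule ℂ X) (h : ∀ φ : X →L[ℂ] ℂ, (∀ v ∈ V, φ v = 0) → φ = 0) :
    Dense (V : Set X) := by
  intro x
  by_contra hx
  have hconv : Convex ℝ (closure (V : Set X)) :=
    ((V.restrictScalars ℝ).convex (𝕜 := ℝ)).closure
  obtain ⟨φ, u, hu, hux⟩ := RCLike.geometric_hahn_banach_closed_point (𝕜 := ℂ) hconv
    isClosed_closure hx
  have hV : ∀ v ∈ V, φ v = 0 := by
    intro v hv
    by_contra hne
    have h1 := hu (((((|u| + 1 : ℝ) : ℂ)) * (φ v)⁻¹) • v) (subset_closure (V.smul_mem _ hv))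
    rw [map_smul, smul_eq_mul, mul_assoc, inv_mul_cancel₀ hne, mul_one] at h1
    have h2 : RCLike.re (((|u| + 1 : ℝ) : ℂ)) = |u| + 1 := Complex.ofReal_re _
    rw [h2] at h1
    linarith [le_abs_self u]
  have h0 := hu 0 (subset_closure V.zero_mem)
  rw [h φ hV] at hux h0
  simp only [_root_.zero_apply, map_zero] at hux h0
  linarith

theorem Complex.isPreconnected_annulus {r : ℝ} (hr : 0 < r) :
    IsPreconnected {t : ℂ | r < ‖t‖ ∧ ‖t‖ < 1} := by
  have h : {t : ℂ | r < ‖t‖ ∧ ‖t‖ < 1} =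
      Complex.exp '' (Complex.reLm ⁻¹' Set.Ioo (Real.log r) 0) := by
    ext t
    constructor
    · rintro ⟨h1, h2⟩
      have ht : t ≠ 0 := norm_pos_iff.1 (hr.trans h1)
      refine ⟨Complex.log t, ⟨?_, ?_⟩, Complex.exp_log ht⟩
      · rw [Complex.reLm_coe, Complex.log_re]; exact Real.log_lt_log hr h1
      · rw [Complex.reLm_coe, Complex.log_re]; exact Real.log_neg (hr.trans h1) h2
    · rintro ⟨w, ⟨h1, h2⟩, rfl⟩
      rw [Complex.reLm_coe] at h1 h2
      change r < ‖Complex.exp w‖ ∧ ‖Complex.exp w‖ < 1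
      rw [Complex.norm_exp]
      exact ⟨(Real.log_lt_iff_lt_exp hr).1 h1, by rwa [Real.exp_lt_one_iff] ⟩
  rw [h]
  have hconv : Convex ℝ (Complex.reLm ⁻¹' Set.Ioo (Real.log r) 0) :=
    Convex.linear_preimage (convex_Ioo _ _) Complex.reLm
  exact hconv.isPreconnected.image _ Complex.continuous_exp.continuousOn

/-- A holomorphic function on the unit disc which is invariant under `t ↦ b / t` near some point
of the annulus `b < ‖t‖ < 1` is constant near `0`. -/
theorem Complex.eqOn_ball_of_eventually_eq_div {b : ℝ} (hb : 0 < b) (hb1 : b < 1) {g : ℂ → ℂ}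
    (hg : DifferentiableOn ℂ g (Metric.ball 0 1)) {t₀ : ℂ} (ht₀ : b < ‖t₀‖) (ht₀1 : ‖t₀‖ < 1)
    (h : ∀ᶠ t in nhds t₀, g t = g (b / t)) :
    ∃ r : ℝ, 0 < r ∧ r < 1 ∧ ∀ t ∈ Metric.ball (0 : ℂ) r, g t = g 0 := by
  set U : Set ℂ := {t : ℂ | b < ‖t‖ ∧ ‖t‖ < 1} with hU
  have hUo : IsOpen U := (isOpen_lt continuous_const continuous_norm).inter
    (isOpen_lt continuous_norm continuous_const)
  have hnorm (t : ℂ) : ‖(b : ℂ) / t‖ = b / ‖t‖ := by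
    rw [norm_div, Complex.norm_real, Real.norm_of_nonneg hb.le]
  have hsub : DifferentiableOn ℂ (fun t => g t - g (b / t)) U := by
    refine (hg.mono fun t ht => ?_).sub (hg.comp ?_ fun t ht => ?_)
    · simpa using ht.2
    · intro t ht
      have ht0 : t ≠ 0 := norm_pos_iff.1 (hb.trans ht.1)
      exact ((differentiableAt_const _).div differentiableAt_id ht0).differentiableWithinAt
    · rw [mem_ball_zero_iff, hnorm, div_lt_one (hb.trans ht.1)]
      exact ht.1
  have hzero : Set.EqOn (fun t => g t - g (b / t)) 0 U :=
    (hsub.analyticOnNhd hUo).eqOn_zero_of_preconnected_of_eventuallyEq_zero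
      (Complex.isPreconnected_annulus hb) ⟨ht₀, ht₀1⟩
      (h.mono fun t ht => sub_eq_zero.2 ht)
  have hs1 : √b < 1 := by rw [Real.sqrt_lt' one_pos]; simpa using hb1
  obtain ⟨r, hr, hr1⟩ := exists_between hs1
  have hr0 : 0 < r := (Real.sqrt_pos.2 hb).trans hr
  have hbr : b < r * r := by
    rw [← sq]; exact (Real.sqrt_lt' hr0).1 hr
  refine ⟨r, hr0, hr1, ?_⟩
  have hcl : Metric.closedBall (0 : ℂ) r ⊆ Metric.ball 0 1 := Metric.closedBall_subset_ball hr1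
  have hd : DifferentiableOn ℂ g (Metric.ball 0 r) := hg.mono (Metric.ball_subset_closedBall.trans hcl)
  obtain ⟨c, hc, hmax⟩ := (isCompact_closedBall (0 : ℂ) r).exists_isMaxOn
    ⟨0, Metric.mem_closedBall_self hr0.le⟩ (hg.continuousOn.mono hcl).norm
  obtain ⟨c', hc', hcc'⟩ : ∃ c' ∈ Metric.ball (0 : ℂ) r, ‖g c'‖ = ‖g c‖ := by
    rw [mem_closedBall_zero_iff] at hc
    rcases hc.lt_or_eq with hlt | heq
    · exact ⟨c, mem_ball_zero_iff.2 hlt, rfl⟩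
    · refine ⟨b / c, ?_, ?_⟩
      · rw [mem_ball_zero_iff, hnorm, heq, div_lt_iff₀ hr0]
        exact hbr
      · have hcU : c ∈ U := ⟨by rw [heq]; nlinarith, by rw [heq]; exact hr1⟩
        rw [← sub_eq_zero.1 (hzero hcU)]
  have hmax' : IsMaxOn (norm ∘ g) (Metric.ball 0 r) c' := by
    intro t ht
    change ‖g t‖ ≤ ‖g c'‖
    rw [hcc']
    exact hmax (Metric.ball_subset_closedBall ht)
  have heq := Complex.eqOn_of_isPreconnected_of_isMaxOn_norm
    (convex_ball (0 : ℂ) r).isPreconnected Metric.isOpen_ball hd hc' hmax'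
  intro t ht
  rw [heq ht, heq (Metric.mem_ball_self hr0)]
  rfl

theorem differentiableOn_tsum_mul_pow {y : ℕ → ℂ} {C : ℝ} (hy : ∀ i, ‖y i‖ ≤ C) :
    DifferentiableOn ℂ (fun t : ℂ => ∑' i, y i * t ^ i) (Metric.ball 0 1) := by
  intro t ht
  obtain ⟨r, htr, hr1⟩ := exists_between (mem_ball_zero_iff.1 ht)
  have hr0 : 0 ≤ r := (norm_nonneg t).trans htr.le
  have h : DifferentiableOn ℂ (fun t : ℂ => ∑' i, y i * t ^ i) (Metric.ball 0 r) := by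
    refine Complex.differentiableOn_tsum_of_summable_norm
      ((summable_geometric_of_lt_one hr0 hr1).mul_left C) (fun i => by fun_prop)
      Metric.isOpen_ball fun i w hw => ?_
    rw [norm_mul, norm_pow]
    have hw' : ‖w‖ ≤ r := (mem_ball_zero_iff.1 hw).le
    gcongr
    · exact (norm_nonneg _).trans (hy 0)
    · exact hy i
  exact (h.differentiableAt (Metric.isOpen_ball.mem_nhds (mem_ball_zero_iff.2 htr))).differentiableWithinAt

theorem eq_zero_of_eventually_tsum_mul_pow_eq_zero {y : ℕ → ℂ} {C : ℝ} (hy : ∀ i, ‖y i‖ ≤ C)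
    (h : ∀ᶠ t : ℂ in nhds 0, ∑' i, y i * t ^ i = 0) (i : ℕ) : y i = 0 := by
  have hps : HasFPowerSeriesAt (0 : ℂ → ℂ) (FormalMultilinearSeries.ofScalars ℂ y) 0 := by
    rw [hasFPowerSeriesAt_iff]
    filter_upwards [h, Metric.ball_mem_nhds (0 : ℂ) one_pos] with t ht ht1
    have hsum : Summable fun i => y i * t ^ i := by
      refine Summable.of_norm_bounded ((summable_geometric_of_lt_one (norm_nonneg t)
        (mem_ball_zero_iff.1 ht1)).mul_left C) fun i => ?_
      rw [norm_mul, norm_pow]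
      gcongr
      exact hy i
    have := hsum.hasSum
    rw [ht] at this
    simpa [mul_comm] using this
  have h0 := hps.eq_zero
  have := congrArg (fun q => FormalMultilinearSeries.coeff q i) h0
  rw [FormalMultilinearSeries.coeff_ofScalars] at this
  exact this

/-- If `t / (1 - t) * f t`, with `f t = ∑ yᵢ tⁱ`, is invariant under `t ↦ b / t` near a point of
the annulus `b < ‖t‖ < 1`, then `f = 0`. -/
theorem eq_zero_of_eventually_reflection_symmetric {b : ℝ} (hb : 0 < b) (hb1 : b < 1) {y : ℕ → ℂ}
    {C : ℝ} (hy : ∀ i, ‖y i‖ ≤ C) {t₀ : ℂ} (ht₀ : b < ‖t₀‖) (ht₀1 : ‖t₀‖ < 1)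
    (h : ∀ᶠ t : ℂ in nhds t₀, t / (1 - t) * ∑' i, y i * t ^ i =
      (b / t) / (1 - b / t) * ∑' i, y i * (b / t) ^ i) (i : ℕ) : y i = 0 := by
  have hne {t : ℂ} (ht : t ∈ Metric.ball (0 : ℂ) 1) : 1 - t ≠ 0 := by
    intro h0
    rw [mem_ball_zero_iff, ← sub_eq_zero.1 h0, norm_one] at ht
    exact lt_irrefl _ ht
  have hf := differentiableOn_tsum_mul_pow hy
  have hg : DifferentiableOn ℂ (fun t : ℂ => t / (1 - t) * ∑' i, y i * t ^ i)
      (Metric.ball 0 1) := by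
    refine DifferentiableOn.mul (fun t ht => ?_) hf
    have := hne ht
    fun_prop (disch := assumption)
  obtain ⟨r, hr, hr1, hzero⟩ := Complex.eqOn_ball_of_eventually_eq_div hb hb1 hg ht₀ ht₀1 h
  have hpunct : ∀ t ∈ Metric.ball (0 : ℂ) r, t ≠ 0 → ∑' i, y i * t ^ i = 0 := by
    intro t ht ht0
    have h1 := hzero t ht
    simp only [zero_div, zero_mul] at h1
    exact (mul_eq_zero.1 h1).resolve_left
      (div_ne_zero ht0 (hne (Metric.ball_subset_ball hr1.le ht)))
  refine eq_zero_of_eventually_tsum_mul_pow_eq_zero hy ?_ i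
  have hcont : ContinuousAt (fun t : ℂ => ∑' i, y i * t ^ i) 0 :=
    (hf.continuousOn.continuousAt (Metric.ball_mem_nhds _ one_pos))
  have hev : ∀ᶠ t : ℂ in nhdsWithin 0 {0}ᶜ, ∑' i, y i * t ^ i = 0 := by
    filter_upwards [self_mem_nhdsWithin, mem_nhdsWithin_of_mem_nhds (Metric.ball_mem_nhds 0 hr)]
      with t ht0 ht
    exact hpunct t ht ht0
  have h00 : ∑' i, y i * (0 : ℂ) ^ i = 0 :=
    tendsto_nhds_unique (hcont.tendsto.mono_left nhdsWithin_le_nhds)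
      (tendsto_const_nhds.congr' (hev.mono fun t ht => ht.symm))
  filter_upwards [Metric.ball_mem_nhds (0 : ℂ) hr] with t ht
  by_cases ht0 : t = 0
  · rw [ht0, h00]
  · exact hpunct t ht ht0

namespace SummableSeq

/-- The geometric sequence `(tⁱ)ᵢ` in `ℓ¹`. -/
noncomputable def geom (t : ℂ) (ht : ‖t‖ < 1) : SummableSeq :=
  ofSummable (fun i => t ^ i) (by simpa using summable_geometric_of_lt_one (norm_nonneg t) ht)

theorem walkOp_geom {p : ℝ} {t s : ℂ} (ht : ‖t‖ < 1)
    (hts : (p : ℂ) * (t * s) = 1 - p) (ht0 : t ≠ 0) :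
    walkOp p (geom t ht) = ((p : ℂ) * (t + s)) • geom t ht -
      ((1 - p) * (1 - t) / t : ℂ) • lp.single 1 0 (1 : ℂ) := by
  refine lp.ext ?_
  rw [coe_walkOp]
  funext i
  rw [lp.coeFn_sub, lp.coeFn_smul, lp.coeFn_smul, Pi.sub_apply, Pi.smul_apply, Pi.smul_apply,
    lp.single_apply]
  simp only [smul_eq_mul, geom, ofSummable_apply, Wop]
  have hs : (1 - p : ℂ) / t = p * s := by rw [← hts]; field_simp
  cases i with
  | zero =>
    simp only [if_true, Pi.single_eq_same, mul_one, pow_zero, zero_add, pow_one]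
    have : (1 - p) * (1 - t) / t = p * s * (1 - t) := by rw [← hs]; ring
    rw [this]
    push_cast
    linear_combination (-1 : ℂ) * hts
  | succ i =>
    have h0 : Pi.single (M := fun _ : ℕ => ℂ) 0 (1 : ℂ) (i + 1) = 0 :=
      Pi.single_eq_of_ne (by omega) _
    rw [h0]
    simp only [Nat.add_eq_zero_iff, one_ne_zero, and_false, if_false, Nat.add_sub_cancel]
    push_cast
    linear_combination (-t ^ i) * hts

/-- Eigenvectors of `W_p` in `ℓ¹`, for the eigenvalue `p * (t + s)` where `p * (t * s) = 1 - p`. -/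
theorem walkOp_eigenvector {p : ℝ} {t s : ℂ} (ht : ‖t‖ < 1) (hs : ‖s‖ < 1)
    (hts : (p : ℂ) * (t * s) = 1 - p) (ht0 : t ≠ 0) (hs0 : s ≠ 0) :
    walkOp p ((t / (1 - t)) • geom t ht - (s / (1 - s)) • geom s hs) =
      ((p : ℂ) * (t + s)) • ((t / (1 - t)) • geom t ht - (s / (1 - s)) • geom s hs) := by
  have hne {t : ℂ} (ht : ‖t‖ < 1) : 1 - t ≠ 0 := by
    intro h0
    rw [← sub_eq_zero.1 h0, norm_one] at ht
    exact lt_irrefl _ ht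
  have h1 := hne ht
  have h2 := hne hs
  rw [map_sub, map_smul, map_smul, walkOp_geom ht hts ht0,
    walkOp_geom hs (by rw [mul_comm s, hts]) hs0, add_comm s t, smul_sub, smul_sub, smul_sub,
    smul_smul, smul_smul, smul_smul, smul_smul, smul_smul, smul_smul]
  have e1 : t / (1 - t) * ((1 - p) * (1 - t) / t) = 1 - p := by field_simp
  have e2 : s / (1 - s) * ((1 - p) * (1 - s) / s) = 1 - p := by field_simp
  rw [e1, e2, mul_comm (t / (1 - t)), mul_comm (s / (1 - s))]
  abel

theorem apply_geom (φ : SummableSeq →L[ℂ] ℂ) (t : ℂ) (ht : ‖t‖ < 1) :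
    φ (geom t ht) = ∑' i, φ (lp.single 1 i (1 : ℂ)) * t ^ i := by
  have h := (lp.hasSum_single ENNReal.one_ne_top (geom t ht)).mapL φ
  rw [← h.tsum_eq]
  refine tsum_congr fun i => ?_
  have : lp.single 1 i (geom t ht i) = t ^ i • (lp.single 1 i (1 : ℂ) : SummableSeq) := by
    rw [← lp.single_smul, smul_eq_mul, mul_one]; rfl
  rw [this, map_smul, smul_eq_mul, mul_comm]

theorem eq_zero_of_apply_single {φ : SummableSeq →L[ℂ] ℂ}
    (h : ∀ i, φ (lp.single 1 i (1 : ℂ)) = 0) : φ = 0 := by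
  refine ContinuousLinearMap.ext fun x => ?_
  have hx := (lp.hasSum_single ENNReal.one_ne_top x).mapL φ
  rw [← hx.tsum_eq]
  have (i : ℕ) : φ (lp.single 1 i (x i)) = 0 := by
    have : lp.single 1 i (x i) = x i • (lp.single 1 i (1 : ℂ) : SummableSeq) := by
      rw [← lp.single_smul, smul_eq_mul, mul_one]
    rw [this, map_smul, h, smul_zero]
  simp [this]

end SummableSeq

/-- If `S` is a right inverse of `W`, eigenvectors of `W` with eigenvalue `μ`, `‖μ‖ * ‖S‖ < 1`, are
limits of vectors in the kernels of powers of `W`. -/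
theorem mem_closure_ker_pow_of_eigenvector {X : Type*} [NormedAddCommGroup X] [NormedSpace ℂ X]
    {W S : X →L[ℂ] X} (hWS : W * S = 1) {μ : ℂ} {v : X} (hv : W v = μ • v)
    (hμ : ‖μ‖ * ‖S‖ < 1) : v ∈ closure {x | ∃ n : ℕ, (W ^ n) x = 0} := by
  have hWSn (n : ℕ) : W ^ n * S ^ n = 1 := by
    induction n with
    | zero => simp
    | succ n ih => rw [pow_succ, pow_succ', mul_assoc, ← mul_assoc W, hWS, one_mul, ih]
  have hWn (n : ℕ) : (W ^ n) v = μ ^ n • v := by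
    induction n with
    | zero => simp
    | succ n ih =>
      rw [pow_succ]
      change (W ^ n) (W v) = _
      rw [hv, map_smul, ih, smul_smul, pow_succ']
  have hlim : Tendsto (fun n : ℕ => ((μ • S) ^ n) v) atTop (nhds 0) := by
    have h := tendsto_pow_atTop_nhds_zero_of_norm_lt_one (x := μ • S) (by rwa [norm_smul])
    have h' := ((ContinuousLinearMap.apply ℂ X v).continuous.tendsto 0).comp h
    rw [map_zero] at h'
    exact h'
  have hlim' : Tendsto (fun n : ℕ => v - ((μ • S) ^ n) v) atTop (nhds v) := by
    simpa using hlim.const_sub v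
  refine mem_closure_of_tendsto hlim' (Eventually.of_forall fun n => ⟨n, ?_⟩)
  have h1 : (W ^ n) ((S ^ n) v) = v := by
    change (W ^ n * S ^ n) v = v
    rw [hWSn]; rfl
  have h2 : ((μ • S) ^ n) v = μ ^ n • (S ^ n) v := by
    rw [smul_pow]; rfl
  rw [map_sub, h2, map_smul, h1, hWn, sub_self]

/-- The union of the kernels of the powers of `T`. -/
def kerPowUnion {X : Type*} [NormedAddCommGroup X] [NormedSpace ℂ X] (T : X →L[ℂ] X) :
    Submodule ℂ X where
  carrier := {x | ∃ n : ℕ, (T ^ n) x = 0}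
  zero_mem' := ⟨0, map_zero _⟩
  smul_mem' := by
    rintro c x ⟨n, hn⟩
    exact ⟨n, by rw [map_smul, hn, smul_zero]⟩
  add_mem' := by
    rintro x y ⟨n, hn⟩ ⟨m, hm⟩
    refine ⟨n + m, ?_⟩
    have h1 : (T ^ (n + m)) x = (T ^ m) ((T ^ n) x) := by rw [add_comm, pow_add]; rfl
    have h2 : (T ^ (n + m)) y = (T ^ n) ((T ^ m) y) := by rw [pow_add]; rfl
    rw [map_add, h1, h2, hn, hm, map_zero, map_zero, add_zero]

theorem dense_ker_pow_walkOp {p : ℝ} (hp : 1 / 2 < p) (hp1 : p < 1) :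
    Dense {x | ∃ n : ℕ, (SummableSeq.walkOp p ^ n) x = 0} := by
  refine Submodule.dense_of_forall_dual (kerPowUnion (SummableSeq.walkOp p)) fun φ hφ => ?_
  have hp0 : 0 < p := by linarith
  have hpc : (p : ℂ) ≠ 0 := by exact_mod_cast hp0.ne'
  set b : ℝ := (1 - p) / p with hb
  have hb0 : 0 < b := div_pos (by linarith) hp0
  have hb1 : b < 1 := SummableSeq.one_sub_div_lt_one hp
  have hpb : (p : ℂ) * b = 1 - p := by
    rw [hb]; push_cast; field_simp
  refine SummableSeq.eq_zero_of_apply_single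
    (eq_zero_of_eventually_reflection_symmetric hb0 hb1 (C := ‖φ‖) (t₀ := Complex.I * (√b : ℝ))
      (fun i => ?_) ?_ ?_ ?_)
  · refine (φ.le_opNorm _).trans ?_
    rw [lp.norm_single one_pos, norm_one, mul_one]
  · rw [norm_mul, Complex.norm_I, one_mul, Complex.norm_real,
      Real.norm_of_nonneg (Real.sqrt_nonneg b), Real.lt_sqrt hb0.le]
    nlinarith
  · rw [norm_mul, Complex.norm_I, one_mul, Complex.norm_real,
      Real.norm_of_nonneg (Real.sqrt_nonneg b), Real.sqrt_lt' one_pos]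
    simpa using hb1
  · set t₀ : ℂ := Complex.I * (√b : ℝ) with ht₀
    have hsq : ((√b : ℝ) : ℂ) ^ 2 = b := by exact_mod_cast Real.sq_sqrt hb0.le
    have hnorm : ‖t₀‖ = √b := by
      rw [ht₀, norm_mul, Complex.norm_I, one_mul, Complex.norm_real,
        Real.norm_of_nonneg (Real.sqrt_nonneg b)]
    have hsb : 0 < √b := Real.sqrt_pos.2 hb0
    have ht₀0 : t₀ ≠ 0 := norm_pos_iff.1 (hnorm ▸ hsb)
    have hμ0 : (p : ℂ) * (t₀ + b / t₀) = 0 := by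
      have : t₀ + b / t₀ = 0 := by
        field_simp
        rw [ht₀, mul_pow, hsq, Complex.I_sq]
        ring
      rw [this, mul_zero]
    have hcont : ContinuousAt (fun t : ℂ => ‖(p : ℂ) * (t + b / t)‖ * ‖SummableSeq.walkInv p‖)
        t₀ := by
      fun_prop (disch := assumption)
    have e1 : ∀ᶠ t in nhds t₀, ‖(p : ℂ) * (t + b / t)‖ * ‖SummableSeq.walkInv p‖ < 1 :=
      hcont.eventually_lt_const (by beta_reduce; rw [hμ0, norm_zero, zero_mul]; exact one_pos)
    have e2 : ∀ᶠ t in nhds t₀, b < ‖t‖ := by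
      refine continuous_norm.continuousAt.eventually_const_lt ?_
      beta_reduce
      rw [hnorm, Real.lt_sqrt hb0.le]
      nlinarith
    have e3 : ∀ᶠ t in nhds t₀, ‖t‖ < 1 := by
      refine continuous_norm.continuousAt.eventually_lt_const ?_
      beta_reduce
      rw [hnorm, Real.sqrt_lt' one_pos]
      simpa using hb1
    filter_upwards [e1, e2, e3] with t h1 h2 h3
    have ht0 : t ≠ 0 := norm_pos_iff.1 (hb0.trans h2)
    have hbc : (b : ℂ) ≠ 0 := by exact_mod_cast hb0.ne'
    have hs : ‖(b : ℂ) / t‖ < 1 := by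
      rw [norm_div, Complex.norm_real, Real.norm_of_nonneg hb0.le, div_lt_one (hb0.trans h2)]
      exact h2
    have hts : (p : ℂ) * (t * (b / t)) = 1 - p := by
      rw [mul_div_cancel₀ _ ht0, hpb]
    have heig := SummableSeq.walkOp_eigenvector h3 hs hts ht0 (div_ne_zero hbc ht0)
    have hmem := mem_closure_ker_pow_of_eigenvector (SummableSeq.walkOp_mul_walkInv hp hp1) heig h1
    have hzero := (isClosed_eq φ.continuous continuous_const).closure_subset_iff.2
      (show {x | ∃ n : ℕ, (SummableSeq.walkOp p ^ n) x = 0} ⊆ {x | φ x = 0} from hφ) hmem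
    change φ _ = 0 at hzero
    rw [map_sub, map_smul, map_smul, SummableSeq.apply_geom, SummableSeq.apply_geom] at hzero
    exact sub_eq_zero.1 hzero

instance SummableSeq.instSeparableSpace : TopologicalSpace.SeparableSpace SummableSeq := by
  let s : Set SummableSeq := Set.range fun i : ℕ => lp.single 1 i (1 : ℂ)
  have hs : TopologicalSpace.IsSeparable (Submodule.span ℂ s : Set SummableSeq) :=
    (Set.countable_range _).isSeparable.span
  have hd : Dense (Submodule.span ℂ s : Set SummableSeq) :=
    Submodule.dense_of_forall_dual _ fun φ hφ =>
      SummableSeq.eq_zero_of_apply_single fun i => hφ _ (Submodule.subset_span ⟨i, rfl⟩)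
  rw [← TopologicalSpace.isSeparable_univ_iff, ← hd.closure_eq]
  exact hs.closure

theorem iterate_smul_Wop (p : ℝ) (lam : ℂ) (x : SummableSeq) (n : ℕ) :
    (fun (x : ℕ → ℂ) i => lam * Wop p x i)^[n] x = ⇑(((lam • SummableSeq.walkOp p) ^ n) x) := by
  induction n with
  | zero => rfl
  | succ n ih =>
    rw [Function.iterate_succ_apply', ih, pow_succ']
    funext i
    rw [← SummableSeq.coe_walkOp]
    rfl

theorem exists_dense_orbit_smul_walkOp {p : ℝ} (hp : 1 / 2 < p) (hp1 : p < 1) {lam : ℂ}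
    (hlam : 1 / (2 * p - 1) < ‖lam‖) :
    ∃ x : SummableSeq, ∀ z : SummableSeq, ∀ ε : ℝ, 0 < ε →
      HasPosLowerDensity {n : ℕ | ‖((lam • SummableSeq.walkOp p) ^ n) x - z‖ < ε} := by
  have hlam0 : 0 < ‖lam‖ := (one_div_pos.2 (by linarith)).trans hlam
  have hne : lam ≠ 0 := norm_pos_iff.1 hlam0
  refine exists_dense_orbit_of_dense_ker _ (lam⁻¹ • SummableSeq.walkInv p) ?_ ?_ ?_
  · rw [smul_mul_smul_comm, mul_inv_cancel₀ hne, one_smul, SummableSeq.walkOp_mul_walkInv hp hp1]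
  · rw [norm_smul, norm_inv, inv_mul_lt_iff₀ hlam0, mul_one]
    exact (SummableSeq.norm_walkInv_le hp hp1).trans_lt hlam
  · refine (dense_ker_pow_walkOp hp hp1).mono ?_
    rintro x ⟨n, hn⟩
    refine ⟨n, ?_⟩
    rw [smul_pow]
    change lam ^ n • (SummableSeq.walkOp p ^ n) x = 0
    rw [hn, smul_zero]

/-- Frequent hypercyclicity on `ℓ¹` passes to larger spaces in which `ℓ¹` is dense. -/
theorem freqHypercyclicOn_of_summableSeq {p : ℝ} (hp : 1 / 2 < p) (hp1 : p < 1) {lam : ℂ}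
    (hlam : 1 / (2 * p - 1) < ‖lam‖) {mem : (ℕ → ℂ) → Prop}
    {dlt : (ℕ → ℂ) → (ℕ → ℂ) → ℝ → Prop} (hmem : ∀ x : SummableSeq, mem x)
    (happrox : ∀ z, mem z → ∀ ε : ℝ, 0 < ε → ∃ z' : SummableSeq, ∃ δ : ℝ, 0 < δ ∧
      ∀ v : SummableSeq, ‖v - z'‖ < δ → dlt v z ε) :
    FreqHypercyclicOn mem dlt (fun x i => lam * Wop p x i) := by
  obtain ⟨x, hx⟩ := exists_dense_orbit_smul_walkOp hp hp1 hlam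
  refine ⟨x, hmem x, fun z hz ε hε => ?_⟩
  obtain ⟨z', δ, hδ, h⟩ := happrox z hz ε hε
  refine ((hx z' δ hδ).mono fun n hn => ?_).liminf_pos
  change dlt _ z ε
  rw [iterate_smul_Wop]
  exact h _ hn

/-- The truncation of a sequence to its first `N` terms. -/
def SummableSeq.truncate (z : ℕ → ℂ) (N : ℕ) : SummableSeq :=
  SummableSeq.ofSummable (fun i => if i < N then z i else 0)
    (summable_of_hasFiniteSupport ((Set.finite_lt_nat N).subset fun i hi => by
      by_contra h
      simp only [Set.mem_ofPred_eq] at h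
      simp [h] at hi))

theorem SummableSeq.truncate_apply (z : ℕ → ℂ) (N i : ℕ) :
    SummableSeq.truncate z N i = if i < N then z i else 0 := rfl

theorem memc0_summableSeq (x : SummableSeq) : memc0 x :=
  tendsto_zero_iff_norm_tendsto_zero.2 x.summable_norm.tendsto_atTop_zero

theorem exists_approx_c0 {z : ℕ → ℂ} (hz : memc0 z) {ε : ℝ} (hε : 0 < ε) :
    ∃ z' : SummableSeq, ∃ δ : ℝ, 0 < δ ∧ ∀ v : SummableSeq, ‖v - z'‖ < δ → distC0lt v z ε := by
  have hz' : ∀ᶠ i in atTop, ‖z i‖ < ε / 2 :=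
    (tendsto_zero_iff_norm_tendsto_zero.1 hz).eventually_lt_const (half_pos hε)
  obtain ⟨N, hN⟩ := eventually_atTop.1 hz'
  refine ⟨SummableSeq.truncate z N, ε / 2, half_pos hε, fun v hv i => ?_⟩
  have h1 : ‖v i - SummableSeq.truncate z N i‖ < ε / 2 :=
    (lp.norm_apply_le_norm one_ne_zero (v - SummableSeq.truncate z N) i).trans_lt hv
  have h2 : ‖SummableSeq.truncate z N i - z i‖ ≤ ε / 2 := by
    rw [SummableSeq.truncate_apply]
    split_ifs with h
    · simpa using (half_pos hε).le
    · rw [zero_sub, norm_neg]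
      exact (hN i (not_lt.1 h)).le
  calc ‖v i - z i‖ ≤ _ := norm_sub_le_norm_sub_add_norm_sub _ (SummableSeq.truncate z N i) _
    _ < ε / 2 + ε / 2 := add_lt_add_of_lt_of_le h1 h2
    _ = ε := add_halves ε

theorem memlq_summableSeq {q : ℝ} (hq : 1 ≤ q) (x : SummableSeq) : memlq q x := by
  have h : ∀ᶠ i in atTop, ‖x i‖ ≤ 1 :=
    x.summable_norm.tendsto_atTop_zero.eventually_le_const one_pos
  refine Summable.of_norm_bounded_eventually_nat x.summable_norm (h.mono fun i hi => ?_)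
  rw [Real.norm_of_nonneg (by positivity)]
  exact Real.rpow_le_self_of_le_one (norm_nonneg _) hi hq

theorem add_rpow_le_two_rpow_mul {a b q : ℝ} (ha : 0 ≤ a) (hb : 0 ≤ b) (hq : 0 ≤ q) :
    (a + b) ^ q ≤ 2 ^ q * (a ^ q + b ^ q) := by
  have h : ∀ {a b : ℝ}, 0 ≤ a → a ≤ b → (a + b) ^ q ≤ 2 ^ q * (a ^ q + b ^ q) := by
    intro a b ha hab
    have hb := ha.trans hab
    calc (a + b) ^ q ≤ (2 * b) ^ q := Real.rpow_le_rpow (by linarith) (by linarith) hq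
      _ = 2 ^ q * b ^ q := Real.mul_rpow zero_le_two hb
      _ ≤ 2 ^ q * (a ^ q + b ^ q) := by
        gcongr
        exact le_add_of_nonneg_left (Real.rpow_nonneg ha q)
  rcases le_total a b with hab | hab
  · exact h ha hab
  · rw [add_comm a, add_comm (a ^ q)]
    exact h hb hab

theorem exists_approx_lq {q : ℝ} (hq : 1 ≤ q) {z : ℕ → ℂ} (hz : memlq q z) {ε : ℝ} (hε : 0 < ε) :
    ∃ z' : SummableSeq, ∃ δ : ℝ, 0 < δ ∧
      ∀ v : SummableSeq, ‖v - z'‖ < δ → distLqlt q v z ε := by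
  have hq0 : 0 < q := one_pos.trans_le hq
  set η : ℝ := ε / 2 / 2 ^ q with hη
  have h2q : (0 : ℝ) < 2 ^ q := Real.rpow_pos_of_pos two_pos q
  have hη0 : 0 < η := div_pos (half_pos hε) h2q
  obtain ⟨N, hN⟩ := ((tendsto_sum_nat_add fun i => ‖z i‖ ^ q).eventually_lt_const hη0).exists
  refine ⟨SummableSeq.truncate z N, min 1 η, lt_min one_pos hη0, fun v hv => ?_⟩
  set a : SummableSeq := v - SummableSeq.truncate z N with ha
  let t : ℕ → ℝ := fun i => ‖SummableSeq.truncate z N i - z i‖ ^ q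
  have ht_lt (i : ℕ) (hi : i < N) : t i = 0 := by
    simp only [t, SummableSeq.truncate_apply]
    rw [if_pos hi, sub_self, norm_zero, Real.zero_rpow hq0.ne']
  have ht_ge (i : ℕ) : t (i + N) = ‖z (i + N)‖ ^ q := by
    simp only [t, SummableSeq.truncate_apply]
    rw [if_neg (by omega), zero_sub, norm_neg]
  have ht : Summable t := by
    rw [← summable_nat_add_iff N]
    simp only [ht_ge]
    exact (summable_nat_add_iff N).2 hz
  have ht_tsum : ∑' i, t i < η := by
    rw [← ht.sum_add_tsum_nat_add N,
      Finset.sum_eq_zero fun i hi => ht_lt i (Finset.mem_range.1 hi), zero_add]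
    simpa only [ht_ge] using hN
  have ha1 (i : ℕ) : ‖a i‖ ^ q ≤ ‖a i‖ :=
    Real.rpow_le_self_of_le_one (norm_nonneg _)
      ((lp.norm_apply_le_norm one_ne_zero a i).trans (hv.le.trans (min_le_left _ _))) hq
  have hle (i : ℕ) : ‖v i - z i‖ ^ q ≤ 2 ^ q * (‖a i‖ + t i) := by
    calc ‖v i - z i‖ ^ q ≤ (‖a i‖ + ‖SummableSeq.truncate z N i - z i‖) ^ q :=
          Real.rpow_le_rpow (norm_nonneg _) (norm_sub_le_norm_sub_add_norm_sub _ _ _) hq0.le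
      _ ≤ 2 ^ q * (‖a i‖ ^ q + t i) :=
          add_rpow_le_two_rpow_mul (norm_nonneg _) (norm_nonneg _) hq0.le
      _ ≤ 2 ^ q * (‖a i‖ + t i) := by gcongr; exact ha1 i
  have hsum : Summable fun i => 2 ^ q * (‖a i‖ + t i) := (a.summable_norm.add ht).mul_left _
  change ∑' i, ‖v i - z i‖ ^ q < ε
  calc ∑' i, ‖v i - z i‖ ^ q ≤ ∑' i, 2 ^ q * (‖a i‖ + t i) :=
        (Summable.of_nonneg_of_le (fun i => by positivity) hle hsum).tsum_le_tsum hle hsum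
    _ = 2 ^ q * (‖a‖ + ∑' i, t i) := by
        rw [tsum_mul_left, a.summable_norm.tsum_add ht, SummableSeq.norm_eq_tsum]
    _ < 2 ^ q * (η + η) := by
        gcongr
        exact hv.trans_le (min_le_right _ _)
    _ = ε := by rw [hη]; field_simp; ring

/-- For `p ∈ (1/2, 1)` and `λ ∈ ℂ` with `|λ| > 1/(2p-1)`, the operator `λ W_p` is
frequently hypercyclic on `c₀` and on every `ℓ^q`, `q ≥ 1`. -/
theorem stmt7 (p : ℝ) (hp : 1/2 < p) (hp1 : p < 1)
    (lam : ℂ) (hlam : 1 / (2*p - 1) < ‖lam‖) :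
    FreqHypercyclicOn memc0 distC0lt (fun x i => lam * Wop p x i) ∧
    ∀ q : ℝ, 1 ≤ q →
      FreqHypercyclicOn (memlq q) (distLqlt q) (fun x i => lam * Wop p x i) := by
  exact ⟨freqHypercyclicOn_of_summableSeq hp hp1 hlam memc0_summableSeq
      fun _ hz _ hε => exists_approx_c0 hz hε,
    fun q hq => freqHypercyclicOn_of_summableSeq hp hp1 hlam (memlq_summableSeq hq)
      fun _ hz _ hε => exists_approx_lq hq hz hε⟩
end

section
/- For p = 1/2, the operator \overline{W}_{1/2} acting on l^1(ℤ) is not supercyclic: for every y ∈ l^1(ℤ), the set {λ \overline{W}_{1/2}^n y : λ ∈ ℂ, n ∈ ℕ} is not dense in l^1(ℤ). -/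
open Filter

/-- The transition operator of the simple random walk on `ℤ` with jump probability `p`:
`(W̄_p x)_i = (1-p) x_{i-1} + p x_{i+1}` for all `i ∈ ℤ`. -/
noncomputable def WZop (p : ℝ) (x : ℤ → ℂ) : ℤ → ℂ := fun i =>
  ((1 - p : ℝ) : ℂ) * x (i - 1) + (p : ℂ) * x (i + 1)

/-- Membership in `c₀(ℤ)`: two-sided sequences tending to `0` at infinity. -/
def memc0Z (x : ℤ → ℂ) : Prop := Filter.Tendsto x (Filter.cocompact ℤ) (nhds 0)

/-- Membership in `ℓ^q(ℤ)`: `∑_{i ∈ ℤ} ‖x i‖^q < ∞`. -/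
def memlqZ (q : ℝ) (x : ℤ → ℂ) : Prop := Summable (fun i : ℤ => ‖x i‖ ^ q)

/-- Sup-norm distance between `x` and `z` is (at most) `ε`, coordinatewise strict form. -/
def distC0ltZ (x z : ℤ → ℂ) (ε : ℝ) : Prop := ∀ i, ‖x i - z i‖ < ε

/-- The `q`-th power of the `ℓ^q(ℤ)` distance between `x` and `z` is `< ε`. -/
def distLqltZ (q : ℝ) (x z : ℤ → ℂ) (ε : ℝ) : Prop := (∑' i : ℤ, ‖x i - z i‖ ^ q) < ε

/-- `T` is hypercyclic on the space of two-sided sequences given by membership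
predicate `mem` with distance predicate `dlt`. -/
def HypercyclicOnZ (mem : (ℤ → ℂ) → Prop) (dlt : (ℤ → ℂ) → (ℤ → ℂ) → ℝ → Prop)
    (T : (ℤ → ℂ) → (ℤ → ℂ)) : Prop :=
  ∃ x, mem x ∧ ∀ z, mem z → ∀ ε : ℝ, 0 < ε → ∃ n : ℕ, dlt (T^[n] x) z ε

/-- `T` is supercyclic on the space of two-sided sequences given by membership
predicate `mem` with distance predicate `dlt`. -/
def SupercyclicOnZ (mem : (ℤ → ℂ) → Prop) (dlt : (ℤ → ℂ) → (ℤ → ℂ) → ℝ → Prop)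
    (T : (ℤ → ℂ) → (ℤ → ℂ)) : Prop :=
  ∃ x, mem x ∧ ∀ z, mem z → ∀ ε : ℝ, 0 < ε →
    ∃ (lam : ℂ) (n : ℕ), dlt (fun i => lam * T^[n] x i) z ε

theorem summable_norm_WZop (p : ℝ) {x : ℤ → ℂ} (hx : Summable fun i => ‖x i‖) :
    Summable fun i => ‖WZop p x i‖ := by
  have hl : Summable fun i : ℤ => ‖x (i - 1)‖ := hx.comp_injective (sub_left_injective (b := 1))
  have hr : Summable fun i : ℤ => ‖x (i + 1)‖ := hx.comp_injective (add_left_injective 1)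
  refine Summable.of_nonneg_of_le (fun _ => norm_nonneg _) (fun i => ?_)
    ((hl.mul_left ‖((1 - p : ℝ) : ℂ)‖).add (hr.mul_left ‖(p : ℂ)‖))
  rw [WZop, ← norm_mul, ← norm_mul]
  exact norm_add_le _ _

theorem summable_norm_iterate_WZop (p : ℝ) {x : ℤ → ℂ} (hx : Summable fun i => ‖x i‖) (n : ℕ) :
    Summable fun i => ‖(WZop p)^[n] x i‖ := by
  induction n with
  | zero => exact hx
  | succ n ih =>
    simp only [Function.iterate_succ_apply']
    exact summable_norm_WZop p ih

theorem summable_bounded_mul {w x : ℤ → ℂ} {C : ℝ} (hw : ∀ k, ‖w k‖ ≤ C)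
    (hx : Summable fun i => ‖x i‖) : Summable fun i => w i * x i := by
  refine Summable.of_norm_bounded (hx.mul_left C) fun i => ?_
  rw [norm_mul]
  exact mul_le_mul_of_nonneg_right (hw i) (norm_nonneg _)

/-- A bounded sequence in the kernel of the dual operator annihilates the range of the symmetric
walk operator. -/
theorem tsum_mul_WZop_half_eq_zero {w x : ℤ → ℂ} {C : ℝ} (hw : ∀ k, ‖w k‖ ≤ C)
    (hker : ∀ k, w (k + 1) + w (k - 1) = 0) (hx : Summable fun i => ‖x i‖) :
    ∑' i, w i * WZop (1 / 2) x i = 0 := by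
  have hl : Summable fun i => w (i + 1) * x i := summable_bounded_mul (fun k => hw (k + 1)) hx
  have hr : Summable fun i => w (i - 1) * x i := summable_bounded_mul (fun k => hw (k - 1)) hx
  have hl' : HasSum (fun i => w i * x (i - 1)) (∑' i, w (i + 1) * x i) := by
    rw [← (Equiv.addRight (1 : ℤ)).hasSum_iff]
    simpa [Function.comp_def] using hl.hasSum
  have hr' : HasSum (fun i => w i * x (i + 1)) (∑' i, w (i - 1) * x i) := by
    rw [← (Equiv.subRight (1 : ℤ)).hasSum_iff]
    simpa [Function.comp_def] using hr.hasSum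
  have hsum : (∑' i, w (i + 1) * x i) + ∑' i, w (i - 1) * x i = 0 := by
    rw [← hl.tsum_add hr]
    simp [← add_mul, hker]
  have h := (hl'.add hr').mul_left (1 / 2 : ℂ)
  rw [hsum, mul_zero] at h
  rw [← h.tsum_eq]
  congr 1
  ext i
  simp only [WZop]
  push_cast
  ring

/-- The dual of the symmetric walk operator has a two-dimensional kernel in `ℓ^∞(ℤ)`, so some
nonzero element of it annihilates any prescribed `y ∈ ℓ¹(ℤ)`. -/
theorem exists_bounded_kernel_annihilating {y : ℤ → ℂ} (hy : Summable fun i => ‖y i‖) :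
    ∃ (w : ℤ → ℂ) (C : ℝ), (∀ k, ‖w k‖ ≤ C) ∧ (∀ k, w (k + 1) + w (k - 1) = 0) ∧
      (∑' i, w i * y i = 0) ∧ ∃ j, w j ≠ 0 := by
  have hI : Complex.I ≠ 0 := Complex.I_ne_zero
  have hnI : -Complex.I ≠ 0 := neg_ne_zero.mpr hI
  obtain ⟨α, β, hne, hαβ⟩ : ∃ α β : ℂ, ¬(α = 0 ∧ β = 0) ∧
      α * ∑' i, Complex.I ^ i * y i + β * ∑' i, (-Complex.I) ^ i * y i = 0 := by
    by_cases ha : ∑' i, Complex.I ^ i * y i = 0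
    · exact ⟨1, 0, by simp, by simp [ha]⟩
    · exact ⟨∑' i, (-Complex.I) ^ i * y i, -∑' i, Complex.I ^ i * y i,
        fun h => ha (neg_eq_zero.mp h.2), by ring⟩
  refine ⟨fun k => α * Complex.I ^ k + β * (-Complex.I) ^ k, ‖α‖ + ‖β‖, fun k => ?_, fun k => ?_,
    ?_, ?_⟩
  · exact (norm_add_le _ _).trans_eq (by simp)
  · simp only [zpow_add_one₀ hI, zpow_add_one₀ hnI, zpow_sub_one₀ hI, zpow_sub_one₀ hnI, inv_neg,
      Complex.inv_I]
    ring
  · have h₁ : Summable fun i => Complex.I ^ i * y i :=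
      summable_bounded_mul (C := 1) (fun k => by simp) hy
    have h₂ : Summable fun i => (-Complex.I) ^ i * y i :=
      summable_bounded_mul (C := 1) (fun k => by simp) hy
    rw [← hαβ, ← tsum_mul_left, ← tsum_mul_left, ← (h₁.mul_left α).tsum_add (h₂.mul_left β)]
    congr 1
    ext i
    ring
  · by_contra! h
    have h0 : α + β = 0 := by simpa using h 0
    have h1 : α * Complex.I + β * (-Complex.I) = 0 := by simpa using h 1
    have hsub : α - β = 0 := by
      apply (mul_eq_zero.mp _).resolve_right hI
      linear_combination h1
    exact hne ⟨by linear_combination (h0 + hsub) / 2, by linear_combination (h0 - hsub) / 2⟩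

/-- For `p = 1/2`, the operator `W̄_{1/2}` acting on `ℓ¹(ℤ)` is not supercyclic:
no `y ∈ ℓ¹(ℤ)` has projective orbit dense in `ℓ¹(ℤ)`. -/
theorem stmt16 : ¬ SupercyclicOnZ (memlqZ 1) (distLqltZ 1) (WZop (1/2)) := by
  rintro ⟨y, hy, hdense⟩
  simp only [memlqZ, distLqltZ, Real.rpow_one] at hy hdense
  obtain ⟨w, C, hw, hker, hwy, j, hj⟩ := exists_bounded_kernel_annihilating hy
  have hC : 0 < C := (norm_pos_iff.mpr hj).trans_le (hw j)
  have hz : Summable fun i => ‖(Pi.single j 1 : ℤ → ℂ) i‖ :=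
    summable_of_ne_finset_zero (s := {j}) fun i hi => by
      simp [Pi.single_eq_of_ne (Finset.notMem_singleton.mp hi)]
  obtain ⟨c, n, hlt⟩ := hdense (Pi.single j 1) hz (‖w j‖ / C) (div_pos (norm_pos_iff.mpr hj) hC)
  have hTn := summable_norm_iterate_WZop (1 / 2) hy n
  have horbit : ∑' i, w i * (WZop (1 / 2))^[n] y i = 0 := by
    cases n with
    | zero => exact hwy
    | succ n =>
      simp only [Function.iterate_succ_apply']
      exact tsum_mul_WZop_half_eq_zero hw hker (summable_norm_iterate_WZop (1 / 2) hy n)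
  have hdiff : Summable fun i => ‖c * (WZop (1 / 2))^[n] y i - (Pi.single j 1 : ℤ → ℂ) i‖ := by
    refine Summable.of_nonneg_of_le (fun _ => norm_nonneg _) (fun i => norm_sub_le _ _) ?_
    simpa only [norm_mul] using (hTn.mul_left ‖c‖).add hz
  have hval : ∑' i, w i * (c * (WZop (1 / 2))^[n] y i - (Pi.single j 1 : ℤ → ℂ) i) = -w j := by
    have h₁ := ((summable_bounded_mul hw hTn).hasSum.mul_left c)
    rw [horbit, mul_zero] at h₁
    have h₂ : HasSum (fun i => w i * (Pi.single j 1 : ℤ → ℂ) i) (w j) := by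
      convert hasSum_single (f := fun i => w i * (Pi.single j 1 : ℤ → ℂ) i) j ?_ using 1
      · simp
      · intro i hi
        simp [Pi.single_eq_of_ne hi]
    rw [← zero_sub, ← (h₁.sub h₂).tsum_eq]
    congr 1
    ext i
    ring
  have hbound := tsum_of_norm_bounded (hdiff.hasSum.mul_left C)
    (f := fun i => w i * (c * (WZop (1 / 2))^[n] y i - (Pi.single j 1 : ℤ → ℂ) i)) fun i => by
      rw [norm_mul]
      exact mul_le_mul_of_nonneg_right (hw i) (norm_nonneg _)
  rw [hval, norm_neg] at hbound
  rw [lt_div_iff₀ hC] at hlt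
  linarith
end
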